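/- Sublinear spreading implies vanishing γ-limit: Assume (H1) and (H2)[α] for every α ∈ (1/3,1). If (1/t)·∫_{ℝ³} |x| |φ(t,x)|² dx → 0 as t → ∞, then for every α ∈ (1/3,1) and every smooth characteristic function F of [1,∞), lim_{t→∞} Γ_{F,α}(t) = 0. -/

import Mathlib

noncomputable section

open MeasureTheory Filter Topology Real

abbrev R3 : Type := EuclideanSpace ℝ (Fin 3)

/-- `F` is a smooth characteristic function of `[1, ∞)`:
smooth, nondecreasing, `F = 0` on `(-∞, 1/2]`, `F = 1` on `[1, ∞)`, values in `[0,1]`. -/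
def IsSmoothChar (F : ℝ → ℝ) : Prop :=
  ContDiff ℝ (⊤ : ℕ∞) F ∧ Monotone F ∧ (∀ x : ℝ, x ≤ 1 / 2 → F x = 0) ∧
    (∀ x : ℝ, 1 ≤ x → F x = 1) ∧ ∀ x : ℝ, 0 ≤ F x ∧ F x ≤ 1

/-- `g(x) = β(|x|)` with `β` smooth, nondecreasing and convex on `[0,∞)`,
`β r = r` for `r ≥ 2`, and `β` constant on `[0,1]`. -/
structure GoodG (g : R3 → ℝ) (β : ℝ → ℝ) : Prop where
  smooth_g : ContDiff ℝ (⊤ : ℕ∞) g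
  smooth_beta : ContDiff ℝ (⊤ : ℕ∞) β
  mono_beta : MonotoneOn β (Set.Ici 0)
  convex_beta : ConvexOn ℝ (Set.Ici 0) β
  beta_eq_id : ∀ r : ℝ, 2 ≤ r → β r = r
  beta_const : ∀ r ∈ Set.Icc (0 : ℝ) 1, β r = β 0
  g_eq : ∀ x : R3, g x = β ‖x‖

/-- The (pointwise) Laplacian of `ψ : ℝ³ → ℂ`. -/
def laplacian (ψ : R3 → ℂ) (x : R3) : ℂ :=
  ∑ j : Fin 3,
    fderiv ℝ (fun y => fderiv ℝ ψ y (EuclideanSpace.single j 1)) x (EuclideanSpace.single j 1)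

/-- The quadratic form `⟨γ⟩_ψ = Im ∫ conj ψ (∇g · ∇ψ)` of `γ = ½(∇g·p + p·∇g)`. -/
def gammaExp (g : R3 → ℝ) (ψ : R3 → ℂ) : ℝ :=
  (∫ x : R3, (starRingEnd ℂ) (ψ x) * fderiv ℝ ψ x (gradient g x)).im

/-- `Γ_{F,α}(t) = ⟨γ⟩_ψ` with `ψ = F(⟨·⟩/t^α)·φ(t,·)`. -/
def GammaF (g : R3 → ℝ) (φ : ℝ → R3 → ℂ) (F : ℝ → ℝ) (α t : ℝ) : ℝ :=
  gammaExp g fun x => (F (g x / t ^ α) : ℂ) * φ t x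

/-- The standing hypotheses on the solution `φ` of `i∂_tφ + Δφ = 𝒩(|φ|,|x|,t)φ`,
including the global `H¹` bound (H1). -/
structure SolSetting (N : ℝ → ℝ → ℝ → ℝ) (φ : ℝ → R3 → ℂ) : Prop where
  smooth : ContDiffOn ℝ (⊤ : ℕ∞) (fun p : ℝ × R3 => φ p.1 p.2) (Set.Ici 0 ×ˢ Set.univ)
  radial : ∀ t : ℝ, ∀ x y : R3, ‖x‖ = ‖y‖ → φ t x = φ t y
  eqn : ∀ t : ℝ, 0 ≤ t → ∀ x : R3,
    Complex.I * deriv (fun s => φ s x) t + laplacian (φ t) x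
      = (N ‖φ t x‖ ‖x‖ t : ℂ) * φ t x
  l2 : ∀ t : ℝ, 0 ≤ t → Integrable fun x : R3 => ‖φ t x‖ ^ 2
  grad_l2 : ∀ t : ℝ, 0 ≤ t → Integrable fun x : R3 => ‖fderiv ℝ (φ t) x‖ ^ 2
  wt_l2 : ∀ t : ℝ, 0 ≤ t → Integrable fun x : R3 => (1 + ‖x‖) * ‖φ t x‖ ^ 2
  H1 : ∃ C : ℝ, ∀ t : ℝ, 0 ≤ t →
    (∫ x : R3, ‖φ t x‖ ^ 2) + (∫ x : R3, ‖fderiv ℝ (φ t) x‖ ^ 2) ≤ C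

/-- Hypothesis (H2)[α, β₀]: uniform decay of the interaction in the exterior region. -/
def H2 (g : R3 → ℝ) (N : ℝ → ℝ → ℝ → ℝ) (φ : ℝ → R3 → ℂ) (α β₀ : ℝ) : Prop :=
  ∀ F : ℝ → ℝ, IsSmoothChar F → ∃ C > (0 : ℝ), ∀ t : ℝ, 1 ≤ t → ∀ x : R3,
    |F (g x / t ^ α) * N ‖φ t x‖ ‖x‖ t| ≤ C * t ^ (-β₀)

/-- The open quadrant `t > 0`, `r > 0`. -/
def quad : Set (ℝ × ℝ) := Set.Ioi 0 ×ˢ Set.Ioi 0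

/-- Partial derivative in time. -/
def dT (A : ℝ × ℝ → ℝ) (p : ℝ × ℝ) : ℝ := fderiv ℝ A p (1, 0)

/-- Partial derivative in radius. -/
def dR (A : ℝ × ℝ → ℝ) (p : ℝ × ℝ) : ℝ := fderiv ℝ A p (0, 1)

/-- Smoothness on the quadrant. -/
def SmQ (A : ℝ × ℝ → ℝ) : Prop := ContDiffOn ℝ (⊤ : ℕ∞) A quad

lemma two_le_inf : (2 : WithTop ℕ∞) ≤ ((⊤ : ℕ∞) : WithTop ℕ∞) :=
  WithTop.coe_le_coe.2 (le_top : (2 : ℕ∞) ≤ ⊤)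

lemma isOpen_quad : IsOpen quad := isOpen_Ioi.prod isOpen_Ioi

lemma mem_quad {t r : ℝ} (ht : 0 < t) (hr : 0 < r) : (t, r) ∈ quad := ⟨ht, hr⟩

lemma SmQ.fderiv_apply {A : ℝ × ℝ → ℝ} (hA : SmQ A) (v : ℝ × ℝ) :
    SmQ (fun p => fderiv ℝ A p v) := by
  have h1 : ContDiffOn ℝ (⊤ : ℕ∞) (fderiv ℝ A) quad :=
    hA.fderiv_of_isOpen isOpen_quad (by norm_num)
  exact h1.clm_apply contDiffOn_const

lemma SmQ.dT {A : ℝ × ℝ → ℝ} (hA : SmQ A) : SmQ (dT A) := hA.fderiv_apply _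
lemma SmQ.dR {A : ℝ × ℝ → ℝ} (hA : SmQ A) : SmQ (dR A) := hA.fderiv_apply _

lemma SmQ.mul {A B : ℝ × ℝ → ℝ} (hA : SmQ A) (hB : SmQ B) : SmQ (fun p => A p * B p) :=
  ContDiffOn.mul hA hB
lemma SmQ.add {A B : ℝ × ℝ → ℝ} (hA : SmQ A) (hB : SmQ B) : SmQ (fun p => A p + B p) :=
  ContDiffOn.add hA hB
lemma SmQ.sub {A B : ℝ × ℝ → ℝ} (hA : SmQ A) (hB : SmQ B) : SmQ (fun p => A p - B p) :=
  ContDiffOn.sub hA hB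
lemma SmQ.const (c : ℝ) : SmQ (fun _ => c) := contDiffOn_const

lemma SmQ.contDiffAt {A : ℝ × ℝ → ℝ} (hA : SmQ A) {p : ℝ × ℝ} (hp : p ∈ quad) :
    ContDiffAt ℝ (⊤ : ℕ∞) A p := ContDiffOn.contDiffAt hA (isOpen_quad.mem_nhds hp)

lemma SmQ.diffAt {A : ℝ × ℝ → ℝ} (hA : SmQ A) {p : ℝ × ℝ} (hp : p ∈ quad) :
    DifferentiableAt ℝ A p := (hA.contDiffAt hp).differentiableAt (by simp)

lemma SmQ.hasDerivAt_T {A : ℝ × ℝ → ℝ} (hA : SmQ A) {t r : ℝ} (ht : 0 < t) (hr : 0 < r) :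
    HasDerivAt (fun s => A (s, r)) (_root_.dT A (t, r)) t := by
  have h := (hA.diffAt (mem_quad ht hr)).hasFDerivAt
  exact h.comp_hasDerivAt t ((hasDerivAt_id t).prodMk (hasDerivAt_const t r))

lemma SmQ.hasDerivAt_R {A : ℝ × ℝ → ℝ} (hA : SmQ A) {t r : ℝ} (ht : 0 < t) (hr : 0 < r) :
    HasDerivAt (fun s => A (t, s)) (_root_.dR A (t, r)) r := by
  have h := (hA.diffAt (mem_quad ht hr)).hasFDerivAt
  exact h.comp_hasDerivAt r ((hasDerivAt_const r t).prodMk (hasDerivAt_id r))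

lemma SmQ.dT_eq {A : ℝ × ℝ → ℝ} (hA : SmQ A) {t r c : ℝ} (ht : 0 < t) (hr : 0 < r)
    (h : HasDerivAt (fun s => A (s, r)) c t) : _root_.dT A (t, r) = c :=
  (hA.hasDerivAt_T ht hr).unique h

lemma SmQ.dR_eq {A : ℝ × ℝ → ℝ} (hA : SmQ A) {t r c : ℝ} (ht : 0 < t) (hr : 0 < r)
    (h : HasDerivAt (fun s => A (t, s)) c r) : _root_.dR A (t, r) = c :=
  (hA.hasDerivAt_R ht hr).unique h

lemma SmQ.symm {A : ℝ × ℝ → ℝ} (hA : SmQ A) {p : ℝ × ℝ} (hp : p ∈ quad) :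
    _root_.dT (_root_.dR A) p = _root_.dR (_root_.dT A) p := by
  have hs := (hA.contDiffAt hp).isSymmSndFDerivAt (by simpa using two_le_inf)
  have h1 : DifferentiableAt ℝ (fderiv ℝ A) p :=
    ((hA.contDiffAt hp).fderiv_right (m := 1) (by norm_num; exact two_le_inf)).differentiableAt (by simp)
  have key : ∀ v w : ℝ × ℝ, fderiv ℝ (fun q => fderiv ℝ A q v) p w = fderiv ℝ (fderiv ℝ A) p w v := by
    intro v w
    have := (h1.hasFDerivAt.clm_apply (hasFDerivAt_const v p)).fderiv
    rw [this]; simp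
  show fderiv ℝ (fun q => fderiv ℝ A q (0, 1)) p (1, 0)
    = fderiv ℝ (fun q => fderiv ℝ A q (1, 0)) p (0, 1)
  rw [key, key]
  exact hs _ _

lemma SmQ.contOn_slice {A : ℝ × ℝ → ℝ} (hA : SmQ A) {t : ℝ} (ht : 0 < t) :
    ContinuousOn (fun r => A (t, r)) (Set.Ioi 0) := by
  refine (ContDiffOn.continuousOn hA).comp (by fun_prop) ?_
  intro r hr
  exact mem_quad ht hr

lemma SmQ.intervalIntegrable {A : ℝ × ℝ → ℝ} (hA : SmQ A) {t c d : ℝ} (ht : 0 < t) (hc : 0 < c)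
    (hcd : c ≤ d) : IntervalIntegrable (fun r => A (t, r)) volume c d := by
  apply ContinuousOn.intervalIntegrable
  refine (hA.contOn_slice ht).mono ?_
  rw [Set.uIcc_of_le hcd]
  intro x hx
  exact lt_of_lt_of_le hc hx.1

lemma SmQ.leibniz {A : ℝ × ℝ → ℝ} (hA : SmQ A) {t c d : ℝ} (ht : 0 < t) (hc : 0 < c)
    (hcd : c ≤ d) :
    HasDerivAt (fun s => ∫ r in c..d, A (s, r)) (∫ r in c..d, _root_.dT A (t, r)) t := by
  have hK : IsCompact (Set.Icc (t / 2) (2 * t) ×ˢ Set.Icc c d) := isCompact_Icc.prod isCompact_Icc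
  have hsub : (Set.Icc (t / 2) (2 * t) ×ˢ Set.Icc c d) ⊆ quad := by
    rintro ⟨x, y⟩ ⟨hx, hy⟩
    exact mem_quad (lt_of_lt_of_le (by positivity) hx.1) (lt_of_lt_of_le hc hy.1)
  obtain ⟨C, hC⟩ := hK.exists_bound_of_continuousOn ((ContDiffOn.continuousOn hA.dT).mono hsub)
  have hs : Set.Icc (t / 2) (2 * t) ∈ 𝓝 t := Icc_mem_nhds (by linarith) (by linarith)
  have hmeas : ∀ (B : ℝ × ℝ → ℝ), SmQ B → ∀ x, 0 < x →
      AEStronglyMeasurable (fun r => B (x, r)) (volume.restrict (Set.uIoc c d)) := by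
    intro B hB x hx
    exact (intervalIntegrable_iff.1 (hB.intervalIntegrable hx hc hcd)).aestronglyMeasurable
  refine (intervalIntegral.hasDerivAt_integral_of_dominated_loc_of_deriv_le
    (F := fun s r => A (s, r)) (F' := fun s r => _root_.dT A (s, r)) (bound := fun _ => C) hs
    ?_ (hA.intervalIntegrable ht hc hcd) (hmeas _ hA.dT t ht) ?_ (by simp) ?_).2
  · filter_upwards [hs] with x hx
    exact hmeas A hA x (lt_of_lt_of_le (by positivity) hx.1)
  · refine Eventually.of_forall fun r hr x hx => ?_
    rw [Set.uIoc_of_le hcd] at hr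
    exact hC (x, r) ⟨hx, hr.1.le, hr.2⟩
  · refine Eventually.of_forall fun r hr x hx => ?_
    rw [Set.uIoc_of_le hcd] at hr
    exact hA.hasDerivAt_T (lt_of_lt_of_le (by positivity) hx.1) (hc.trans hr.1)

lemma SmQ.ftc {B : ℝ × ℝ → ℝ} (hB : SmQ B) {t c d : ℝ} (ht : 0 < t) (hc : 0 < c)
    (hcd : c ≤ d) : ∫ r in c..d, _root_.dR B (t, r) = B (t, d) - B (t, c) := by
  refine intervalIntegral.integral_eq_sub_of_hasDerivAt (f := fun r => B (t, r)) ?_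
    (hB.dR.intervalIntegrable ht hc hcd)
  intro r hr
  rw [Set.uIcc_of_le hcd] at hr
  exact hB.hasDerivAt_R ht (hc.trans_le hr.1)

/-- Leibniz rule with a total derivative removed. -/
lemma SmQ.leibniz_sub {A B Y : ℝ × ℝ → ℝ} (hA : SmQ A) (hB : SmQ B) {t c d : ℝ} (ht : 0 < t)
    (hc : 0 < c) (hcd : c ≤ d) (h1 : B (t, c) = 0) (h2 : B (t, d) = 0)
    (hY : ∀ r, 0 < r → _root_.dT A (t, r) - _root_.dR B (t, r) = Y (t, r)) :
    IntervalIntegrable (fun r => Y (t, r)) volume c d ∧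
    HasDerivAt (fun s => ∫ r in c..d, A (s, r)) (∫ r in c..d, Y (t, r)) t := by
  have e : ∀ r ∈ Set.uIcc c d, _root_.dT A (t, r) - _root_.dR B (t, r) = Y (t, r) := by
    intro r hr
    rw [Set.uIcc_of_le hcd] at hr
    exact hY r (hc.trans_le hr.1)
  have i1 := hA.dT.intervalIntegrable ht hc hcd
  have i2 := hB.dR.intervalIntegrable ht hc hcd
  constructor
  · refine (i1.sub i2).congr ?_
    intro r hr
    exact e r (Set.uIoc_subset_uIcc hr)
  · have := hA.leibniz ht hc hcd
    convert this using 1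
    rw [← intervalIntegral.integral_congr e, intervalIntegral.integral_sub i1 i2,
      hB.ftc ht hc hcd, h1, h2]
    ring

/-- Momentum identity. -/
lemma core_mom {a b W : ℝ × ℝ → ℝ} (ha : SmQ a) (hb : SmQ b) (hW : SmQ W)
    {t r n : ℝ} (ht : 0 < t) (hr : 0 < r)
    (e1 : dT a (t, r) = - dR (dR b) (t, r) + n * b (t, r))
    (e2 : dT b (t, r) = dR (dR a) (t, r) - n * a (t, r)) :
    dT (fun p => W p * (a p * dR b p - b p * dR a p)) (t, r)
    - dR (fun p => W p * (a p * dT b p - b p * dT a p) - W p * (dR a p * dR a p + dR b p * dR b p)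
        - dR W p * (a p * dR a p + b p * dR b p)
        + 1 / 2 * (dR (dR W) p * (a p * a p + b p * b p))) (t, r)
    = dT W (t, r) * (a (t, r) * dR b (t, r) - b (t, r) * dR a (t, r))
      + 2 * dR W (t, r) * (dR a (t, r) ^ 2 + dR b (t, r) ^ 2)
      - 1 / 2 * dR (dR (dR W)) (t, r) * (a (t, r) ^ 2 + b (t, r) ^ 2)
      + n * dR W (t, r) * (a (t, r) ^ 2 + b (t, r) ^ 2)
      + 2 * (n * W (t, r)) * (a (t, r) * dR a (t, r) + b (t, r) * dR b (t, r)) := by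
  have s1 := ha.symm (mem_quad ht hr)
  have s2 := hb.symm (mem_quad ht hr)
  have hA : SmQ (fun p => W p * (a p * dR b p - b p * dR a p)) :=
    hW.mul ((ha.mul hb.dR).sub (hb.mul ha.dR))
  have hB : SmQ (fun p => W p * (a p * dT b p - b p * dT a p)
        - W p * (dR a p * dR a p + dR b p * dR b p)
        - dR W p * (a p * dR a p + b p * dR b p)
        + 1 / 2 * (dR (dR W) p * (a p * a p + b p * b p))) :=
    (((hW.mul ((ha.mul hb.dT).sub (hb.mul ha.dT))).sub
      (hW.mul ((ha.dR.mul ha.dR).add (hb.dR.mul hb.dR)))).sub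
      (hW.dR.mul ((ha.mul ha.dR).add (hb.mul hb.dR)))).add
      ((SmQ.const _).mul (hW.dR.dR.mul ((ha.mul ha).add (hb.mul hb))))
  rw [hA.dT_eq ht hr ((hW.hasDerivAt_T ht hr).mul
    (((ha.hasDerivAt_T ht hr).mul (hb.dR.hasDerivAt_T ht hr)).sub
      ((hb.hasDerivAt_T ht hr).mul (ha.dR.hasDerivAt_T ht hr))))]
  have a0 := ha.hasDerivAt_R ht hr
  have a1 := ha.dR.hasDerivAt_R ht hr
  have b0 := hb.hasDerivAt_R ht hr
  have b1 := hb.dR.hasDerivAt_R ht hr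
  have at0 := ha.dT.hasDerivAt_R ht hr
  have bt0 := hb.dT.hasDerivAt_R ht hr
  have w0 := hW.hasDerivAt_R ht hr
  have w1 := hW.dR.hasDerivAt_R ht hr
  have w2 := hW.dR.dR.hasDerivAt_R ht hr
  rw [hB.dR_eq ht hr ((((w0.mul ((a0.mul bt0).sub (b0.mul at0))).sub
      (w0.mul ((a1.mul a1).add (b1.mul b1)))).sub
      (w1.mul ((a0.mul a1).add (b0.mul b1)))).add
      ((w2.mul ((a0.mul a0).add (b0.mul b0))).const_mul (1 / 2)))]
  rw [s1, s2]
  simp only [Pi.mul_apply, Pi.add_apply, Pi.sub_apply]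
  rw [e1, e2]
  ring

/-- Mass identity. -/
lemma core_mass {a b K : ℝ × ℝ → ℝ} (ha : SmQ a) (hb : SmQ b) (hK : SmQ K)
    {t r n : ℝ} (ht : 0 < t) (hr : 0 < r)
    (e1 : dT a (t, r) = - dR (dR b) (t, r) + n * b (t, r))
    (e2 : dT b (t, r) = dR (dR a) (t, r) - n * a (t, r)) :
    dT (fun p => K p * (a p * a p + b p * b p)) (t, r)
    - dR (fun p => (-2) * (K p * (a p * dR b p - b p * dR a p))) (t, r)
    = dT K (t, r) * (a (t, r) ^ 2 + b (t, r) ^ 2)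
      + 2 * dR K (t, r) * (a (t, r) * dR b (t, r) - b (t, r) * dR a (t, r)) := by
  have hA : SmQ (fun p => K p * (a p * a p + b p * b p)) :=
    hK.mul ((ha.mul ha).add (hb.mul hb))
  have hB : SmQ (fun p => (-2) * (K p * (a p * dR b p - b p * dR a p))) :=
    (SmQ.const _).mul (hK.mul ((ha.mul hb.dR).sub (hb.mul ha.dR)))
  have a0 := ha.hasDerivAt_R ht hr
  have a1 := ha.dR.hasDerivAt_R ht hr
  have b0 := hb.hasDerivAt_R ht hr
  have b1 := hb.dR.hasDerivAt_R ht hr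
  have at0 := ha.hasDerivAt_T ht hr
  have bt0 := hb.hasDerivAt_T ht hr
  rw [hA.dT_eq ht hr ((hK.hasDerivAt_T ht hr).mul ((at0.mul at0).add (bt0.mul bt0)))]
  rw [hB.dR_eq ht hr (((hK.hasDerivAt_R ht hr).mul ((a0.mul b1).sub (b0.mul a1))).const_mul (-2))]
  simp only [Pi.mul_apply, Pi.add_apply, Pi.sub_apply]
  rw [e1, e2]
  ring

lemma SmQ.congr {A A' : ℝ × ℝ → ℝ} (hA : SmQ A) (h : ∀ p ∈ quad, A' p = A p) : SmQ A' :=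
  ContDiffOn.congr hA h

lemma dR_congr {A A' : ℝ × ℝ → ℝ} (h : ∀ p ∈ quad, A p = A' p) : ∀ p ∈ quad, dR A p = dR A' p := by
  intro p hp
  have : A =ᶠ[𝓝 p] A' := by
    filter_upwards [isOpen_quad.mem_nhds hp] with q hq using h q hq
  show fderiv ℝ A p _ = fderiv ℝ A' p _
  rw [this.fderiv_eq]

lemma SmQ.dR_eqOn {A A1 : ℝ × ℝ → ℝ} (hA : SmQ A)
    (h : ∀ t r : ℝ, 0 < t → 0 < r → HasDerivAt (fun s => A (t, s)) (A1 (t, r)) r) :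
    ∀ p ∈ quad, _root_.dR A p = A1 p := by
  rintro ⟨t, r⟩ ⟨ht, hr⟩
  exact hA.dR_eq ht hr (h t r ht hr)

section char
variable {f : ℝ → ℝ}

lemma char_sq (hf : IsSmoothChar f) : IsSmoothChar (fun x => f x ^ 2) := by
  obtain ⟨h1, h2, h3, h4, h5⟩ := hf
  refine ⟨h1.pow 2, ?_, ?_, ?_, ?_⟩
  · intro x y hxy
    exact pow_le_pow_left₀ (h5 x).1 (h2 hxy) 2
  · intro x hx
    simp [h3 x hx]
  · intro x hx
    simp [h4 x hx]
  · intro x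
    have := h5 x
    exact ⟨by positivity, by nlinarith⟩

lemma contDiff_deriv {h : ℝ → ℝ} (hh : ContDiff ℝ (⊤ : ℕ∞) h) :
    ContDiff ℝ (⊤ : ℕ∞) (deriv h) := (contDiff_infty_iff_deriv.1 hh).2

lemma cd_hasDerivAt {h : ℝ → ℝ} (hh : ContDiff ℝ (⊤ : ℕ∞) h) (x : ℝ) :
    HasDerivAt h (deriv h x) x := ((hh.differentiable (by simp)) x).hasDerivAt

lemma deriv_const_out {h : ℝ → ℝ} (h1 : ∃ c, ∀ x < 1 / 2, h x = c) (h2 : ∃ c, ∀ x > 1, h x = c) :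
    (∀ x < 1 / 2, deriv h x = 0) ∧ ∀ x > 1, deriv h x = 0 := by
  obtain ⟨c1, h1⟩ := h1
  obtain ⟨c2, h2⟩ := h2
  constructor
  · intro x hx
    have : h =ᶠ[𝓝 x] fun _ => c1 := by
      filter_upwards [isOpen_Iio.mem_nhds hx] with y hy using h1 y hy
    rw [this.deriv_eq]; simp
  · intro x hx
    have : h =ᶠ[𝓝 x] fun _ => c2 := by
      filter_upwards [isOpen_Ioi.mem_nhds hx] with y hy using h2 y hy
    rw [this.deriv_eq]; simp

lemma bdd_of_out {h : ℝ → ℝ} (hc : Continuous h) (h1 : ∀ x < 1 / 2, h x = 0)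
    (h2 : ∀ x > 1, h x = 0) : ∃ D : ℝ, ∀ x, |h x| ≤ D := by
  obtain ⟨C, hC⟩ := isCompact_Icc.exists_bound_of_continuousOn (s := Set.Icc (1 / 2 : ℝ) 1)
    hc.continuousOn
  refine ⟨max C 0, fun x => ?_⟩
  by_cases hx : x < 1 / 2
  · simp [h1 x hx]
  by_cases hx' : 1 < x
  · simp [h2 x hx']
  · exact (hC x ⟨by linarith, by linarith⟩).trans (le_max_left _ _)

lemma char_out1 (hf : IsSmoothChar f) :
    (∀ x < 1 / 2, deriv f x = 0) ∧ ∀ x > 1, deriv f x = 0 :=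
  deriv_const_out ⟨0, fun x hx => hf.2.2.1 x hx.le⟩ ⟨1, fun x hx => hf.2.2.2.1 x hx.le⟩

lemma char_out2 (hf : IsSmoothChar f) :
    (∀ x < 1 / 2, deriv (deriv f) x = 0) ∧ ∀ x > 1, deriv (deriv f) x = 0 :=
  deriv_const_out ⟨0, (char_out1 hf).1⟩ ⟨0, (char_out1 hf).2⟩

lemma char_out3 (hf : IsSmoothChar f) :
    (∀ x < 1 / 2, deriv (deriv (deriv f)) x = 0) ∧ ∀ x > 1, deriv (deriv (deriv f)) x = 0 :=
  deriv_const_out ⟨0, (char_out2 hf).1⟩ ⟨0, (char_out2 hf).2⟩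

lemma char_bounds (hf : IsSmoothChar f) : ∃ D : ℝ, 1 ≤ D ∧ ∀ x, |deriv f x| ≤ D ∧
    |deriv (deriv f) x| ≤ D ∧ |deriv (deriv (deriv f)) x| ≤ D := by
  have c1 := contDiff_deriv hf.1
  have c2 := contDiff_deriv c1
  have c3 := contDiff_deriv c2
  obtain ⟨D1, h1⟩ := bdd_of_out c1.continuous (char_out1 hf).1 (char_out1 hf).2
  obtain ⟨D2, h2⟩ := bdd_of_out c2.continuous (char_out2 hf).1 (char_out2 hf).2
  obtain ⟨D3, h3⟩ := bdd_of_out c3.continuous (char_out3 hf).1 (char_out3 hf).2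
  refine ⟨max 1 (max D1 (max D2 D3)), le_max_left _ _, fun x => ⟨?_, ?_, ?_⟩⟩
  · exact (h1 x).trans (by simp)
  · exact (h2 x).trans (by simp)
  · exact (h3 x).trans (by simp)

/-- The primitive of `f`. -/
def prim (f : ℝ → ℝ) (x : ℝ) : ℝ := ∫ y in (0 : ℝ)..x, f y

lemma prim_hasDerivAt (hf : IsSmoothChar f) (x : ℝ) : HasDerivAt (prim f) (f x) x :=
  intervalIntegral.integral_hasDerivAt_right (hf.1.continuous.intervalIntegrable _ _)
    (hf.1.continuous.stronglyMeasurableAtFilter _ _) hf.1.continuous.continuousAt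

lemma prim_contDiff (hf : IsSmoothChar f) : ContDiff ℝ (⊤ : ℕ∞) (prim f) := by
  rw [contDiff_infty_iff_deriv]
  have : deriv (prim f) = f := funext fun x => (prim_hasDerivAt hf x).deriv
  rw [this]
  exact ⟨fun x => (prim_hasDerivAt hf x).differentiableAt, hf.1⟩

lemma prim_zero (hf : IsSmoothChar f) {x : ℝ} (h0 : 0 ≤ x) (hx : x ≤ 1 / 2) : prim f x = 0 := by
  have : ∀ y ∈ Set.uIcc 0 x, f y = 0 := by
    intro y hy
    rw [Set.uIcc_of_le h0] at hy
    exact hf.2.2.1 y (hy.2.trans hx)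
  rw [prim, intervalIntegral.integral_congr (g := fun _ => 0) this]; simp

lemma prim_nonneg (hf : IsSmoothChar f) {x : ℝ} (h0 : 0 ≤ x) : 0 ≤ prim f x :=
  intervalIntegral.integral_nonneg h0 fun y _ => (hf.2.2.2.2 y).1

lemma prim_le (hf : IsSmoothChar f) {x : ℝ} (h0 : 0 ≤ x) : prim f x ≤ x := by
  have := intervalIntegral.integral_mono_on (μ := volume) h0 (hf.1.continuous.intervalIntegrable _ _)
    (g := fun _ => (1 : ℝ)) (by simp) (fun y _ => (hf.2.2.2.2 y).2)
  simpa [prim] using this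

lemma prim_abs (hf : IsSmoothChar f) {x : ℝ} (h0 : 0 ≤ x) : |prim f x - x * f x| ≤ 1 := by
  have h1 := prim_nonneg hf h0
  have h2 := prim_le hf h0
  have h3 := hf.2.2.2.2 x
  by_cases hx : x ≤ 1
  · rw [abs_le]; constructor <;> nlinarith
  · push Not at hx
    have e : prim f x = prim f 1 + (x - 1) := by
      have : ∫ y in (1 : ℝ)..x, f y = x - 1 := by
        have : ∀ y ∈ Set.uIcc 1 x, f y = 1 := by
          intro y hy
          rw [Set.uIcc_of_le hx.le] at hy
          exact hf.2.2.2.1 y hy.1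
        rw [intervalIntegral.integral_congr (g := fun _ => 1) this]; simp
      rw [prim, prim, ← this, intervalIntegral.integral_add_adjacent_intervals]
      · exact hf.1.continuous.intervalIntegrable _ _
      · exact hf.1.continuous.intervalIntegrable _ _
    rw [e, hf.2.2.2.1 x hx.le]
    have := prim_nonneg hf (zero_le_one' ℝ)
    have := prim_le hf (zero_le_one' ℝ)
    rw [abs_le]; constructor <;> linarith

/-- The spatial cutoff. -/
def cut (f : ℝ → ℝ) (ε r : ℝ) : ℝ := 1 - f (ε * log r)

def cut1 (f : ℝ → ℝ) (ε r : ℝ) : ℝ := -(deriv f (ε * log r) * (ε * r⁻¹))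
def cut2 (f : ℝ → ℝ) (ε r : ℝ) : ℝ :=
  -(deriv (deriv f) (ε * log r) * (ε * r⁻¹) * (ε * r⁻¹) + deriv f (ε * log r) * (ε * (-(r ^ 2)⁻¹)))
def cut3 (f : ℝ → ℝ) (ε r : ℝ) : ℝ :=
  -(deriv (deriv (deriv f)) (ε * log r) * (ε * r⁻¹) * (ε * r⁻¹) * (ε * r⁻¹)
    + 3 * (deriv (deriv f) (ε * log r) * (ε * r⁻¹) * (ε * (-(r ^ 2)⁻¹)))
    + deriv f (ε * log r) * (ε * (2 * (r ^ 3)⁻¹)))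

lemma log_d (ε : ℝ) {r : ℝ} (hr : 0 < r) : HasDerivAt (fun s => ε * log s) (ε * r⁻¹) r :=
  (hasDerivAt_log hr.ne').const_mul ε

lemma inv_d {r : ℝ} (hr : 0 < r) : HasDerivAt (fun s : ℝ => s⁻¹) (-(r ^ 2)⁻¹) r :=
  hasDerivAt_inv hr.ne'

lemma cut_d (hf : IsSmoothChar f) (ε : ℝ) {r : ℝ} (hr : 0 < r) :
    HasDerivAt (cut f ε) (cut1 f ε r) r := by
  have := ((cd_hasDerivAt hf.1 (ε * log r)).comp r (log_d ε hr)).const_sub 1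
  exact this

lemma cut1_d (hf : IsSmoothChar f) (ε : ℝ) {r : ℝ} (hr : 0 < r) :
    HasDerivAt (cut1 f ε) (cut2 f ε r) r := by
  have h1 := (cd_hasDerivAt (contDiff_deriv hf.1) (ε * log r)).comp r (log_d ε hr)
  have := (h1.mul ((inv_d hr).const_mul ε)).neg
  exact this

lemma cut2_d (hf : IsSmoothChar f) (ε : ℝ) {r : ℝ} (hr : 0 < r) :
    HasDerivAt (cut2 f ε) (cut3 f ε r) r := by
  have h1 := (cd_hasDerivAt (contDiff_deriv hf.1) (ε * log r)).comp r (log_d ε hr)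
  have h2 := (cd_hasDerivAt (contDiff_deriv (contDiff_deriv hf.1)) (ε * log r)).comp r (log_d ε hr)
  have hi := (inv_d hr).const_mul ε
  have hsq : HasDerivAt (fun s : ℝ => (s ^ 2)⁻¹) (-(2 * r) / (r ^ 2) ^ 2) r := by
    have := (hasDerivAt_pow 2 r).inv (by positivity)
    refine this.congr_deriv ?_
    simp
  have := (((h2.mul hi).mul hi).add (h1.mul (hsq.neg.const_mul ε))).neg
  refine this.congr_deriv ?_
  simp only [cut3, Function.comp, Pi.mul_apply, Pi.neg_apply]
  field_simp
  ring

lemma cut_bounds {D : ℝ} (hD : 1 ≤ D) (hb : ∀ x, |deriv f x| ≤ D ∧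
    |deriv (deriv f) x| ≤ D ∧ |deriv (deriv (deriv f)) x| ≤ D) {ε r : ℝ} (h0 : 0 ≤ ε) (h1 : ε ≤ 1)
    (hr : 1 ≤ r) : |cut1 f ε r| * r ≤ D * ε ∧ |cut1 f ε r| ≤ D * ε ∧ |cut2 f ε r| ≤ 2 * D * ε ∧
      |cut3 f ε r| ≤ 6 * D * ε := by
  obtain ⟨b1, b2, b3⟩ := hb (ε * log r)
  have hr0 : 0 < r := by linarith
  have i1 : r⁻¹ ≤ 1 := inv_le_one_of_one_le₀ hr
  have i0 : 0 ≤ r⁻¹ := by positivity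
  have i2 : (r ^ 2)⁻¹ ≤ 1 := inv_le_one_of_one_le₀ (one_le_pow₀ hr)
  have i20 : 0 ≤ (r ^ 2)⁻¹ := by positivity
  have i3 : (r ^ 3)⁻¹ ≤ 1 := inv_le_one_of_one_le₀ (one_le_pow₀ hr)
  have i30 : 0 ≤ (r ^ 3)⁻¹ := by positivity
  have ei : ε * r⁻¹ ≤ ε := mul_le_of_le_one_right h0 i1
  have ei0 : 0 ≤ ε * r⁻¹ := by positivity
  have ei1 : ε * r⁻¹ ≤ 1 := ei.trans h1
  have ej : ε * (r ^ 2)⁻¹ ≤ ε := mul_le_of_le_one_right h0 i2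
  have ej0 : 0 ≤ ε * (r ^ 2)⁻¹ := by positivity
  have ek : ε * (r ^ 3)⁻¹ ≤ ε := mul_le_of_le_one_right h0 i3
  have ek0 : 0 ≤ ε * (r ^ 3)⁻¹ := by positivity
  have hD0 : 0 ≤ D := by linarith
  have eii : (ε * r⁻¹) * (ε * r⁻¹) ≤ ε := by nlinarith
  have eiii : (ε * r⁻¹) * (ε * r⁻¹) * (ε * r⁻¹) ≤ ε := by nlinarith
  have eij : (ε * r⁻¹) * (ε * (r ^ 2)⁻¹) ≤ ε := by nlinarith
  have key : ∀ x y : ℝ, |x| ≤ D → 0 ≤ y → y ≤ ε → |x * y| ≤ D * ε := by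
    intro x y hx hy hy'
    rw [abs_mul, abs_of_nonneg hy]
    exact mul_le_mul hx hy' hy hD0
  have k1 := key _ _ b1 ei0 ei
  have k2 := key _ _ b2 (by positivity) eii
  have k3 := key _ _ b1 ej0 ej
  have k4 := key _ _ b3 (by positivity) eiii
  have k5 := key _ _ b2 (by positivity) eij
  have k6 := key _ _ b1 ek0 ek
  refine ⟨?_, ?_, ?_, ?_⟩
  · have : |cut1 f ε r| * r = |deriv f (ε * log r)| * ε := by
      rw [cut1, abs_neg, abs_mul, abs_of_nonneg ei0]
      field_simp
    rw [this]
    gcongr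
  · rw [cut1, abs_neg]; exact k1
  · rw [abs_le] at *
    unfold cut2
    constructor <;> linarith
  · rw [abs_le] at *
    unfold cut3
    constructor <;> linarith

lemma cut_mem (hf : IsSmoothChar f) (ε r : ℝ) : 0 ≤ cut f ε r ∧ cut f ε r ≤ 1 := by
  have := hf.2.2.2.2 (ε * log r)
  unfold cut
  constructor <;> linarith

lemma cut_vanish (hf : IsSmoothChar f) {ε r : ℝ} (h : 1 < ε * log r) :
    cut f ε r = 0 ∧ cut1 f ε r = 0 ∧ cut2 f ε r = 0 := by
  simp [cut, cut1, cut2, hf.2.2.2.1 _ h.le, (char_out1 hf).2 _ h, (char_out2 hf).2 _ h]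

/-- The rescaled outgoing cutoff. -/
def wgt (f : ℝ → ℝ) (α t r : ℝ) : ℝ := f (r * t ^ (-α))

lemma wgt_d (f : ℝ → ℝ) (hf : ContDiff ℝ (⊤ : ℕ∞) f) (α t r : ℝ) :
    HasDerivAt (wgt f α t) (wgt (deriv f) α t r * t ^ (-α)) r := by
  have h : HasDerivAt (fun s => s * t ^ (-α)) (1 * t ^ (-α)) r := (hasDerivAt_id r).mul_const _
  have := (cd_hasDerivAt hf (r * t ^ (-α))).comp r h
  refine this.congr_deriv ?_
  simp [wgt]

lemma scale_dT (α r : ℝ) {t : ℝ} (ht : 0 < t) :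
    HasDerivAt (fun s => r * s ^ (-α)) (-α * (r * t ^ (-α)) / t) t := by
  have := (Real.hasDerivAt_rpow_const (p := -α) (Or.inl ht.ne')).const_mul r
  refine this.congr_deriv ?_
  rw [rpow_sub_one ht.ne']
  ring

/-- Momentum weight. -/
def Wt (f : ℝ → ℝ) (α ε : ℝ) (p : ℝ × ℝ) : ℝ := cut f ε p.2 * wgt f α p.1 p.2

/-- Mass weight. -/
def Kt (f : ℝ → ℝ) (α ε : ℝ) (p : ℝ × ℝ) : ℝ :=
  cut f ε p.2 * (p.1 ^ α * prim f (p.2 * p.1 ^ (-α)))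

lemma sm_rpow (a : ℝ) : SmQ (fun p => p.1 ^ a) := by
  intro p hp
  have h1 : p.1 ≠ 0 := ne_of_gt hp.1
  exact (contDiffAt_fst.rpow_const_of_ne h1).contDiffWithinAt

lemma sm_comp {h : ℝ → ℝ} (hh : ContDiff ℝ (⊤ : ℕ∞) h) {A : ℝ × ℝ → ℝ} (hA : SmQ A) :
    SmQ (fun p => h (A p)) := ContDiff.comp_contDiffOn hh hA

lemma sm_snd : SmQ (fun p => p.2) := contDiff_snd.contDiffOn

lemma sm_log : SmQ (fun p => log p.2) := by
  intro p hp
  have h1 : p.2 ≠ 0 := ne_of_gt hp.2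
  exact (contDiffAt_snd.log h1).contDiffWithinAt

lemma sm_cut (hf : IsSmoothChar f) (ε : ℝ) : SmQ (fun p => cut f ε p.2) :=
  (SmQ.const 1).sub (sm_comp hf.1 ((SmQ.const ε).mul sm_log))

lemma sm_Wt (hf : IsSmoothChar f) (α ε : ℝ) : SmQ (Wt f α ε) :=
  (sm_cut hf ε).mul (sm_comp hf.1 (sm_snd.mul (sm_rpow (-α))))

lemma sm_Kt (hf : IsSmoothChar f) (α ε : ℝ) : SmQ (Kt f α ε) :=
  (sm_cut hf ε).mul ((sm_rpow α).mul (sm_comp (prim_contDiff hf) (sm_snd.mul (sm_rpow (-α)))))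

lemma dT_Wt (hf : IsSmoothChar f) (α ε : ℝ) {t r : ℝ} (ht : 0 < t) (hr : 0 < r) :
    dT (Wt f α ε) (t, r) =
      cut f ε r * (wgt (deriv f) α t r * (-α * (r * t ^ (-α)) / t)) := by
  apply (sm_Wt hf α ε).dT_eq ht hr
  exact ((cd_hasDerivAt hf.1 (r * t ^ (-α))).comp t (scale_dT α r ht)).const_mul (cut f ε r)

def Wt1 (f : ℝ → ℝ) (α ε : ℝ) (p : ℝ × ℝ) : ℝ :=
  cut1 f ε p.2 * wgt f α p.1 p.2 + cut f ε p.2 * (wgt (deriv f) α p.1 p.2 * p.1 ^ (-α))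

def Wt2 (f : ℝ → ℝ) (α ε : ℝ) (p : ℝ × ℝ) : ℝ :=
  (cut2 f ε p.2 * wgt f α p.1 p.2 + cut1 f ε p.2 * (wgt (deriv f) α p.1 p.2 * p.1 ^ (-α)))
  + (cut1 f ε p.2 * (wgt (deriv f) α p.1 p.2 * p.1 ^ (-α))
    + cut f ε p.2 * (wgt (deriv (deriv f)) α p.1 p.2 * p.1 ^ (-α) * p.1 ^ (-α)))

def Wt3 (f : ℝ → ℝ) (α ε : ℝ) (p : ℝ × ℝ) : ℝ :=
  cut3 f ε p.2 * wgt f α p.1 p.2 + 3 * (cut2 f ε p.2 * (wgt (deriv f) α p.1 p.2 * p.1 ^ (-α)))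
  + 3 * (cut1 f ε p.2 * (wgt (deriv (deriv f)) α p.1 p.2 * p.1 ^ (-α) * p.1 ^ (-α)))
  + cut f ε p.2 * (wgt (deriv (deriv (deriv f))) α p.1 p.2 * p.1 ^ (-α) * p.1 ^ (-α) * p.1 ^ (-α))

lemma dR_Wt (hf : IsSmoothChar f) (α ε : ℝ) : ∀ p ∈ quad, dR (Wt f α ε) p = Wt1 f α ε p := by
  apply (sm_Wt hf α ε).dR_eqOn
  intro t r ht hr
  exact (cut_d hf ε hr).mul (wgt_d f hf.1 α t r)

lemma sm_Wt1 (hf : IsSmoothChar f) (α ε : ℝ) : SmQ (Wt1 f α ε) :=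
  (sm_Wt hf α ε).dR.congr fun p hp => (dR_Wt hf α ε p hp).symm

lemma dR_Wt1 (hf : IsSmoothChar f) (α ε : ℝ) : ∀ p ∈ quad, dR (Wt1 f α ε) p = Wt2 f α ε p := by
  apply (sm_Wt1 hf α ε).dR_eqOn
  intro t r ht hr
  exact ((cut1_d hf ε hr).mul (wgt_d f hf.1 α t r)).add
    ((cut_d hf ε hr).mul ((wgt_d _ (contDiff_deriv hf.1) α t r).mul_const (t ^ (-α))))

lemma sm_Wt2 (hf : IsSmoothChar f) (α ε : ℝ) : SmQ (Wt2 f α ε) :=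
  (sm_Wt1 hf α ε).dR.congr fun p hp => (dR_Wt1 hf α ε p hp).symm

lemma dR_Wt2 (hf : IsSmoothChar f) (α ε : ℝ) : ∀ p ∈ quad, dR (Wt2 f α ε) p = Wt3 f α ε p := by
  apply (sm_Wt2 hf α ε).dR_eqOn
  intro t r ht hr
  have c1 := contDiff_deriv hf.1
  have h0 := cut_d hf ε hr
  have h1 := cut1_d hf ε hr
  have h2 := cut2_d hf ε hr
  have w0 := wgt_d f hf.1 α t r
  have w1 := (wgt_d _ c1 α t r).mul_const (t ^ (-α))
  have w2 := ((wgt_d _ (contDiff_deriv c1) α t r).mul_const (t ^ (-α))).mul_const (t ^ (-α))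
  have := ((h2.mul w0).add (h1.mul w1)).add ((h1.mul w1).add (h0.mul w2))
  refine this.congr_deriv ?_
  simp only [Wt3]
  ring

lemma dRR_Wt (hf : IsSmoothChar f) (α ε : ℝ) :
    ∀ p ∈ quad, dR (dR (Wt f α ε)) p = Wt2 f α ε p := fun p hp =>
  (dR_congr (dR_Wt hf α ε) p hp).trans (dR_Wt1 hf α ε p hp)

lemma dRRR_Wt (hf : IsSmoothChar f) (α ε : ℝ) :
    ∀ p ∈ quad, dR (dR (dR (Wt f α ε))) p = Wt3 f α ε p := fun p hp =>
  (dR_congr (dRR_Wt hf α ε) p hp).trans (dR_Wt2 hf α ε p hp)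

lemma Wt3_bound (hf : IsSmoothChar f) {D : ℝ} (hD : 1 ≤ D) (hb : ∀ x, |deriv f x| ≤ D ∧
    |deriv (deriv f) x| ≤ D ∧ |deriv (deriv (deriv f)) x| ≤ D) {α ε t r : ℝ} (h0 : 0 ≤ ε)
    (h1 : ε ≤ 1) (hr : 1 ≤ r) (ht : 1 ≤ t) (hα : 0 ≤ α) :
    |Wt3 f α ε (t, r)| ≤ D * t ^ (-(3 * α)) + 15 * D ^ 2 * ε := by
  obtain ⟨-, c1, c2, c3⟩ := cut_bounds hD hb h0 h1 hr
  have c0 := cut_mem hf ε r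
  obtain ⟨b1, b2, b3⟩ := hb (r * t ^ (-α))
  have b0 := hf.2.2.2.2 (r * t ^ (-α))
  have t0 : 0 < t := by linarith
  have e3 : t ^ (-(3 * α)) = t ^ (-α) * t ^ (-α) * t ^ (-α) := by
    rw [← rpow_add t0, ← rpow_add t0]; congr 1; ring
  have s0 : 0 ≤ t ^ (-α) := by positivity
  have s1 : t ^ (-α) ≤ 1 := rpow_le_one_of_one_le_of_nonpos ht (by linarith)
  rw [e3]
  set s := t ^ (-α)
  have hD0 : 0 ≤ D := by linarith
  have k0 : |cut3 f ε r * wgt f α t r| ≤ 6 * D * ε * 1 := by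
    rw [abs_mul]
    refine mul_le_mul c3 ?_ (abs_nonneg _) (by positivity)
    rw [wgt, abs_of_nonneg b0.1]; exact b0.2
  have k1 : |cut2 f ε r * (wgt (deriv f) α t r * s)| ≤ 2 * D * ε * (D * 1) := by
    rw [abs_mul, abs_mul, abs_of_nonneg s0]
    gcongr
    exact b1
  have k2 : |cut1 f ε r * (wgt (deriv (deriv f)) α t r * s * s)| ≤ D * ε * (D * 1 * 1) := by
    rw [abs_mul, abs_mul, abs_mul, abs_of_nonneg s0]
    gcongr
    exact b2
  have k3 : |cut f ε r * (wgt (deriv (deriv (deriv f))) α t r * s * s * s)| ≤ 1 * (D * s * s * s) := by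
    rw [abs_mul, abs_mul, abs_mul, abs_mul, abs_of_nonneg s0, abs_of_nonneg c0.1]
    gcongr
    · exact c0.2
    · exact b3
  have hDD : D * ε ≤ D ^ 2 * ε := by
    gcongr; nlinarith
  have : |Wt3 f α ε (t, r)| ≤ |cut3 f ε r * wgt f α t r| + 3 * |cut2 f ε r * (wgt (deriv f) α t r * s)|
      + 3 * |cut1 f ε r * (wgt (deriv (deriv f)) α t r * s * s)|
      + |cut f ε r * (wgt (deriv (deriv (deriv f))) α t r * s * s * s)| := by
    show |_ + 3 * _ + 3 * _ + _| ≤ _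
    refine (abs_add_le _ _).trans (add_le_add ((abs_add_le _ _).trans (add_le_add
      ((abs_add_le _ _).trans (add_le_add le_rfl ?_)) ?_)) le_rfl)
    · rw [abs_mul]; simp; rfl
    · rw [abs_mul]; simp; rfl
  nlinarith

lemma dT_Kt (hf : IsSmoothChar f) {α ε : ℝ} (h0 : 0 ≤ α) (h1 : α ≤ 1)
    {t r : ℝ} (ht : 0 < t) (hr : 0 < r) :
    |dT (Kt f α ε) (t, r)| ≤ t ^ (α - 1) := by
  have h : HasDerivAt (fun s => Kt f α ε (s, r)) (cut f ε r * (α * t ^ (α - 1) *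
      (prim f (r * t ^ (-α)) - (r * t ^ (-α)) * f (r * t ^ (-α))))) t := by
    have := ((Real.hasDerivAt_rpow_const (p := α) (Or.inl ht.ne')).mul
      ((prim_hasDerivAt hf (r * t ^ (-α))).comp t (scale_dT α r ht))).const_mul (cut f ε r)
    refine this.congr_deriv ?_
    rw [rpow_sub_one ht.ne']
    simp only [Function.comp]
    ring
  rw [(sm_Kt hf α ε).dT_eq ht hr h, abs_mul, abs_mul, abs_mul]
  have c := cut_mem hf ε r
  have p := prim_abs hf (x := r * t ^ (-α)) (by positivity)
  rw [abs_of_nonneg c.1, abs_of_nonneg h0, abs_of_nonneg (by positivity : 0 ≤ t ^ (α - 1))]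
  have q : 0 ≤ t ^ (α - 1) := by positivity
  calc _ ≤ 1 * (1 * t ^ (α - 1) * 1) := by
        gcongr
        exact c.2
    _ = _ := by ring

lemma dR_Kt (hf : IsSmoothChar f) {D : ℝ} (hD : 1 ≤ D) (hb : ∀ x, |deriv f x| ≤ D ∧
    |deriv (deriv f) x| ≤ D ∧ |deriv (deriv (deriv f)) x| ≤ D) {α ε t r : ℝ} (h0 : 0 ≤ ε)
    (h1 : ε ≤ 1) (hr : 1 ≤ r) (ht : 0 < t) :
    |dR (Kt f α ε) (t, r) - Wt f α ε (t, r)| ≤ D * ε := by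
  have r0 : 0 < r := by linarith
  have tt : t ^ α * t ^ (-α) = 1 := by rw [← rpow_add ht]; simp
  have h : HasDerivAt (fun s => Kt f α ε (t, s)) (cut1 f ε r * (t ^ α * prim f (r * t ^ (-α))) +
      cut f ε r * wgt f α t r) r := by
    have hs : HasDerivAt (fun s => s * t ^ (-α)) (1 * t ^ (-α)) r := (hasDerivAt_id r).mul_const _
    have := (cut_d hf ε r0).mul (((prim_hasDerivAt hf (r * t ^ (-α))).comp r hs).const_mul (t ^ α))
    refine this.congr_deriv ?_
    simp only [Function.comp, wgt]
    linear_combination cut f ε r * f (r * t ^ (-α)) * tt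
  rw [(sm_Kt hf α ε).dR_eq ht r0 h]
  have p0 := prim_nonneg hf (x := r * t ^ (-α)) (by positivity)
  have p1 := prim_le hf (x := r * t ^ (-α)) (by positivity)
  have q : t ^ α * prim f (r * t ^ (-α)) ≤ r := by
    calc _ ≤ t ^ α * (r * t ^ (-α)) := by gcongr
      _ = r * (t ^ α * t ^ (-α)) := by ring
      _ = r := by rw [tt, mul_one]
  have : cut1 f ε r * (t ^ α * prim f (r * t ^ (-α))) +
      cut f ε r * wgt f α t r - Wt f α ε (t, r) = cut1 f ε r * (t ^ α * prim f (r * t ^ (-α))) := by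
    simp [Wt]
  rw [this, abs_mul, abs_of_nonneg (by positivity : 0 ≤ t ^ α * prim f (r * t ^ (-α)))]
  refine le_trans ?_ (cut_bounds hD hb h0 h1 hr).1
  gcongr

lemma Kt_bound (hf : IsSmoothChar f) {α ε t r : ℝ} (hr : 0 < r) (ht : 0 < t) :
    0 ≤ Kt f α ε (t, r) ∧ Kt f α ε (t, r) ≤ r := by
  have tt : t ^ α * t ^ (-α) = 1 := by rw [← rpow_add ht]; simp
  have p0 := prim_nonneg hf (x := r * t ^ (-α)) (by positivity)
  have p1 := prim_le hf (x := r * t ^ (-α)) (by positivity)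
  have q : t ^ α * prim f (r * t ^ (-α)) ≤ r := by
    calc _ ≤ t ^ α * (r * t ^ (-α)) := by gcongr
      _ = r * (t ^ α * t ^ (-α)) := by ring
      _ = r := by rw [tt, mul_one]
  have c := cut_mem hf ε r
  have q0 : 0 ≤ t ^ α * prim f (r * t ^ (-α)) := by positivity
  constructor
  · exact mul_nonneg c.1 q0
  · show cut f ε r * _ ≤ r
    nlinarith
end char

/-- The one-dimensional data. -/
structure Data1 (a b : ℝ × ℝ → ℝ) (n : ℝ → ℝ → ℝ) (f : ℝ → ℝ) (α β₀ M C₀ : ℝ) : Prop where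
  hf : IsSmoothChar f
  hα : 1 / 3 < α
  hα1 : α < 1
  hβ : 1 < β₀
  hC : 0 ≤ C₀
  sa : SmQ a
  sb : SmQ b
  e1 : ∀ t r : ℝ, 0 < t → 0 < r → dT a (t, r) = - dR (dR b) (t, r) + n t r * b (t, r)
  e2 : ∀ t r : ℝ, 0 < t → 0 < r → dT b (t, r) = dR (dR a) (t, r) - n t r * a (t, r)
  iS : ∀ t : ℝ, 1 ≤ t → IntegrableOn (fun r => a (t, r) ^ 2 + b (t, r) ^ 2) (Set.Ioi 2)
  iP : ∀ t : ℝ, 1 ≤ t → IntegrableOn (fun r => dR a (t, r) ^ 2 + dR b (t, r) ^ 2) (Set.Ioi 2)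
  iR : ∀ t : ℝ, 1 ≤ t → IntegrableOn (fun r => r * (a (t, r) ^ 2 + b (t, r) ^ 2)) (Set.Ioi 2)
  hM : ∀ t : ℝ, 1 ≤ t → (∫ r in Set.Ioi 2, (a (t, r) ^ 2 + b (t, r) ^ 2))
    + (∫ r in Set.Ioi 2, (dR a (t, r) ^ 2 + dR b (t, r) ^ 2)) ≤ M
  n1 : ∀ t r : ℝ, 1 ≤ t → 2 ≤ r → |n t r * f (r * t ^ (-α))| ≤ C₀ * t ^ (-β₀)
  n2 : ∀ t r : ℝ, 1 ≤ t → 2 ≤ r → |n t r * deriv f (r * t ^ (-α))| ≤ C₀ * t ^ (-β₀)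

/-- Purely algebraic estimate. -/
lemma pointwise_alg {S P j q X f0 f1 n W3 x1 D C ε ρ s ti τ E1 : ℝ}
    (hS : 0 ≤ S) (hP : 0 ≤ P) (hq : |q| ≤ (S + P) / 2)
    (hjw : ti * |j| ≤ s * P + τ * S)
    (hX0 : 0 ≤ X) (hX1 : X ≤ 1) (hf1 : 0 ≤ f1) (hf1D : f1 ≤ D)
    (hx1 : |x1| ≤ D * ε) (hf0 : 0 ≤ f0) (hf01 : f0 ≤ 1)
    (hε : 0 ≤ ε) (hε1 : ε ≤ 1) (hs : 0 ≤ s) (hs1 : s ≤ 1) (hτ : 0 ≤ τ) (hti : 0 ≤ ti)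
    (hD : 1 ≤ D) (hρ : f1 * ρ ≤ f1) (hρ0 : 0 ≤ ρ)
    (hn0 : |n * f0| ≤ C) (hn1 : |n * f1| ≤ C) (hW3 : |W3| ≤ E1 + 15 * D ^ 2 * ε) {α : ℝ}
    (hα0 : 0 ≤ α) (hα1 : α ≤ 1) (hE : 0 ≤ E1) :
    -(D * τ + E1 + (2 + D) * C + 10 * D ^ 2 * ε) * (S + P) ≤
      X * (f1 * (-α * ρ * ti)) * j + 2 * (x1 * f0 + X * (f1 * s)) * P - 1 / 2 * W3 * S
      + n * (x1 * f0 + X * (f1 * s)) * S + 2 * (n * (X * f0)) * q := by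
  have hC : 0 ≤ C := (abs_nonneg _).trans hn0
  -- first pair
  have A1 : -(X * f1 * (ti * |j|)) ≤ X * (f1 * (-α * ρ * ti)) * j := by
    have h1 : X * (f1 * ρ) * α * (ti * |j|) ≤ X * f1 * 1 * (ti * |j|) := by
      gcongr
    have h2 : X * (f1 * ρ) * α * (ti * j) ≤ X * (f1 * ρ) * α * (ti * |j|) := by
      gcongr
      exact le_abs_self j
    nlinarith
  have A2 : X * f1 * (ti * |j|) ≤ X * f1 * (s * P) + D * τ * S := by
    have h1 : X * f1 * (ti * |j|) ≤ X * f1 * (s * P + τ * S) := by gcongr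
    have h2 : X * f1 * (τ * S) ≤ 1 * D * (τ * S) := by gcongr
    nlinarith
  have A3 : 0 ≤ X * f1 * (s * P) := by positivity
  have A4 : -(2 * (D * ε) * P) ≤ 2 * (x1 * f0) * P := by
    have h1 : |x1 * f0| ≤ D * ε * 1 := by
      rw [abs_mul, abs_of_nonneg hf0]; gcongr
    have h2 := (abs_le.1 h1).1
    nlinarith
  have A5 : -(1 / 2 * (E1 + 15 * D ^ 2 * ε) * S) ≤ - (1 / 2 * W3 * S) := by
    have h2 := (abs_le.1 hW3).2
    nlinarith
  have A6 : -((1 + D) * C * S) ≤ n * (x1 * f0 + X * (f1 * s)) * S := by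
    have h1 : |x1 * (n * f0)| ≤ D * 1 * C := by
      rw [abs_mul]
      have : D * ε ≤ D * 1 := by gcongr
      exact mul_le_mul (hx1.trans this) hn0 (abs_nonneg _) (by positivity)
    have h2 : |X * s * (n * f1)| ≤ 1 * 1 * C := by
      rw [abs_mul, abs_mul, abs_of_nonneg hX0, abs_of_nonneg hs]
      gcongr
    have h3 := (abs_le.1 h1).1
    have h4 := (abs_le.1 h2).1
    have : -((1 + D) * C) ≤ n * (x1 * f0 + X * (f1 * s)) := by linarith
    nlinarith
  have A7 : -(C * (S + P)) ≤ 2 * (n * (X * f0)) * q := by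
    have h1 : |X * (n * f0) * q| ≤ 1 * C * ((S + P) / 2) := by
      rw [abs_mul, abs_mul, abs_of_nonneg hX0]
      gcongr
    have := (abs_le.1 h1).1
    linarith
  have E10 : 0 ≤ E1 + 15 * D ^ 2 * ε := (abs_nonneg _).trans hW3
  have hDD : D * ε ≤ D ^ 2 * ε := by gcongr; nlinarith
  have hD2 : 0 ≤ D ^ 2 * ε := by positivity
  have T1 : 0 ≤ D * τ * P := by positivity
  have T2 : 0 ≤ (E1 + 15 * D ^ 2 * ε) * P := by positivity
  have T3 : 0 ≤ (E1 + 15 * D ^ 2 * ε) * S := by positivity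
  have T4 : 0 ≤ (1 + D) * C * P := by positivity
  have T5 : D * ε * P ≤ D ^ 2 * ε * P := by gcongr
  have T6 : 0 ≤ D ^ 2 * ε * P := by positivity
  have T7 : 0 ≤ D ^ 2 * ε * S := by positivity
  have T8 : 0 ≤ E1 * S := by positivity
  have T9 : 0 ≤ E1 * P := by positivity
  linarith

lemma real_ineq1 (a b c d : ℝ) : |a * d - b * c| ≤ ((a ^ 2 + b ^ 2) + (c ^ 2 + d ^ 2)) / 2 := by
  rw [abs_le]
  constructor <;> nlinarith [sq_nonneg (a - d), sq_nonneg (a + d), sq_nonneg (b - c), sq_nonneg (b + c)]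

lemma real_ineq2 (a b c d : ℝ) : |a * c + b * d| ≤ ((a ^ 2 + b ^ 2) + (c ^ 2 + d ^ 2)) / 2 := by
  rw [abs_le]
  constructor <;> nlinarith [sq_nonneg (a - c), sq_nonneg (a + c), sq_nonneg (b - d), sq_nonneg (b + d)]

lemma real_ineq3 (a b c d : ℝ) {s : ℝ} (hs : 0 < s) :
    |a * d - b * c| ≤ s * (c ^ 2 + d ^ 2) + s⁻¹ * (a ^ 2 + b ^ 2) := by
  have e1 : s * s⁻¹ = 1 := mul_inv_cancel₀ hs.ne'
  have key : ∀ x y : ℝ, |x * y| ≤ s * y ^ 2 + s⁻¹ * x ^ 2 := by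
    intro x y
    have h1 : s * y ^ 2 + s⁻¹ * x ^ 2 = s * (|y| - s⁻¹ * |x|) ^ 2 + 2 * (|x| * |y|) := by
      rw [← sq_abs x, ← sq_abs y]
      field_simp
      ring
    rw [h1, abs_mul]
    have : 0 ≤ s * (|y| - s⁻¹ * |x|) ^ 2 := by positivity
    have : 0 ≤ |x| * |y| := by positivity
    linarith
  have h1 := key a d
  have h2 := key b c
  have := abs_sub (a * d) (b * c)
  nlinarith

lemma mono_deriv_nonneg {f : ℝ → ℝ} (hf : Monotone f) (x : ℝ) : 0 ≤ deriv f x :=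
  hf.deriv_nonneg

section trunc
variable {a b : ℝ × ℝ → ℝ} {n : ℝ → ℝ → ℝ} {f : ℝ → ℝ} {α β₀ M C₀ : ℝ}

/-- mass density -/
def dS (a b : ℝ × ℝ → ℝ) (t r : ℝ) : ℝ := a (t, r) ^ 2 + b (t, r) ^ 2
/-- kinetic density -/
def dP (a b : ℝ × ℝ → ℝ) (t r : ℝ) : ℝ := dR a (t, r) ^ 2 + dR b (t, r) ^ 2
/-- momentum density -/
def dJ (a b : ℝ × ℝ → ℝ) (t r : ℝ) : ℝ := a (t, r) * dR b (t, r) - b (t, r) * dR a (t, r)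

/-- truncated momentum -/
def GamE (a b : ℝ × ℝ → ℝ) (f : ℝ → ℝ) (α ε t : ℝ) : ℝ :=
  ∫ r in (2 : ℝ)..exp (2 / ε), Wt f α ε (t, r) * dJ a b t r

/-- truncated weighted mass -/
def MasE (a b : ℝ × ℝ → ℝ) (f : ℝ → ℝ) (α ε t : ℝ) : ℝ :=
  ∫ r in (2 : ℝ)..exp (2 / ε), Kt f α ε (t, r) * dS a b t r

lemma two_le_exp {ε : ℝ} (h0 : 0 < ε) (h1 : ε ≤ 1) : 2 ≤ exp (2 / ε) := by
  have h2 : 2 ≤ 2 / ε := by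
    rw [le_div_iff₀ h0]; linarith
  have := add_one_le_exp (2 / ε)
  linarith

lemma Data1.bd (h : Data1 a b n f α β₀ M C₀) {t d : ℝ} (ht : 1 ≤ t) (hd : 2 ≤ d) :
    IntervalIntegrable (fun r => dS a b t r + dP a b t r) volume 2 d ∧
    ∫ r in (2 : ℝ)..d, (dS a b t r + dP a b t r) ≤ M := by
  have i1 := h.iS t ht
  have i2 := h.iP t ht
  have i3 : IntegrableOn (fun r => dS a b t r + dP a b t r) (Set.Ioi 2) := i1.add i2
  have i4 : IntegrableOn (fun r => dS a b t r + dP a b t r) (Set.Ioc 2 d) :=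
    i3.mono_set Set.Ioc_subset_Ioi_self
  refine ⟨(intervalIntegrable_iff_integrableOn_Ioc_of_le hd).2 i4, ?_⟩
  rw [intervalIntegral.integral_of_le hd]
  have hnn : ∀ r, 0 ≤ dS a b t r + dP a b t r := fun r => by unfold dS dP; positivity
  calc _ ≤ ∫ r in Set.Ioi 2, (dS a b t r + dP a b t r) :=
        setIntegral_mono_set i3 (Eventually.of_forall hnn)
          (Eventually.of_forall Set.Ioc_subset_Ioi_self)
    _ = _ := integral_add i1 i2
    _ ≤ M := h.hM t ht

lemma Data1.mom_deriv (h : Data1 a b n f α β₀ M C₀) {D δ : ℝ} (hD : 1 ≤ D)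
    (hb : ∀ x, |deriv f x| ≤ D ∧ |deriv (deriv f) x| ≤ D ∧ |deriv (deriv (deriv f)) x| ≤ D)
    (d1 : α - 2 ≤ -1 - δ) (d2 : -(3 * α) ≤ -1 - δ) (d3 : -β₀ ≤ -1 - δ)
    {ε t : ℝ} (h0 : 0 < ε) (h1 : ε ≤ 1) (ht : 1 ≤ t) (ht2 : 2 * t ^ (-α) < 1 / 2) :
    ∃ y, HasDerivAt (GamE a b f α ε) y t ∧
      -((2 * D + (2 + D) * C₀) * t ^ (-1 - δ) + 10 * D ^ 2 * ε) * M ≤ y := by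
  have t0 : 0 < t := by linarith
  have hd := two_le_exp h0 h1
  have hd0 : 0 < exp (2 / ε) := exp_pos _
  have hW := sm_Wt h.hf α ε
  have ha := h.sa
  have hb' := h.sb
  have hA : SmQ (fun p => Wt f α ε p * (a p * dR b p - b p * dR a p)) :=
    hW.mul ((ha.mul hb'.dR).sub (hb'.mul ha.dR))
  have hB : SmQ (fun p => Wt f α ε p * (a p * dT b p - b p * dT a p)
        - Wt f α ε p * (dR a p * dR a p + dR b p * dR b p)
        - dR (Wt f α ε) p * (a p * dR a p + b p * dR b p)
        + 1 / 2 * (dR (dR (Wt f α ε)) p * (a p * a p + b p * b p))) :=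
    (((hW.mul ((ha.mul hb'.dT).sub (hb'.mul ha.dT))).sub
      (hW.mul ((ha.dR.mul ha.dR).add (hb'.dR.mul hb'.dR)))).sub
      (hW.dR.mul ((ha.mul ha.dR).add (hb'.mul hb'.dR)))).add
      ((SmQ.const _).mul (hW.dR.dR.mul ((ha.mul ha).add (hb'.mul hb'))))
  set Y : ℝ × ℝ → ℝ := fun p => dT (Wt f α ε) p * (a p * dR b p - b p * dR a p)
      + 2 * dR (Wt f α ε) p * (dR a p ^ 2 + dR b p ^ 2)
      - 1 / 2 * dR (dR (dR (Wt f α ε))) p * (a p ^ 2 + b p ^ 2)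
      + n p.1 p.2 * dR (Wt f α ε) p * (a p ^ 2 + b p ^ 2)
      + 2 * (n p.1 p.2 * Wt f α ε p) * (a p * dR a p + b p * dR b p) with hYdef
  have key := hA.leibniz_sub hB (Y := Y) t0 (c := 2) (d := exp (2 / ε)) (by norm_num) hd
    (by
      have p0 : (t, (2 : ℝ)) ∈ quad := mem_quad t0 (by norm_num)
      have z0 : wgt f α t 2 = 0 := h.hf.2.2.1 _ ht2.le
      have z1 : wgt (deriv f) α t 2 = 0 := (char_out1 h.hf).1 _ ht2
      have z2 : wgt (deriv (deriv f)) α t 2 = 0 := (char_out2 h.hf).1 _ ht2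
      simp only [dRR_Wt h.hf α ε _ p0, dR_Wt h.hf α ε _ p0]
      simp [Wt, Wt1, Wt2, z0, z1, z2])
    (by
      have p0 : (t, exp (2 / ε)) ∈ quad := mem_quad t0 hd0
      have : 1 < ε * log (exp (2 / ε)) := by
        rw [log_exp, mul_div_cancel₀ _ h0.ne']; norm_num
      obtain ⟨z0, z1, z2⟩ := cut_vanish h.hf this
      simp only [dRR_Wt h.hf α ε _ p0, dR_Wt h.hf α ε _ p0]
      simp only [Wt, Wt1, Wt2, z0, z1, z2]
      ring)
    (fun r hr => core_mom ha hb' hW t0 hr (h.e1 t r t0 hr) (h.e2 t r t0 hr))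
  refine ⟨_, key.2, ?_⟩
  obtain ⟨bi, bM⟩ := h.bd ht hd
  set κ : ℝ := (2 * D + (2 + D) * C₀) * t ^ (-1 - δ) + 10 * D ^ 2 * ε with hκ
  have hC := h.hC
  have hκ0 : 0 ≤ κ := by positivity
  have pw : ∀ r ∈ Set.Icc 2 (exp (2 / ε)), -κ * (dS a b t r + dP a b t r) ≤ Y (t, r) := by
    intro r hr
    have r0 : 0 < r := by linarith [hr.1]
    have p0 : (t, r) ∈ quad := mem_quad t0 r0
    have ec := cut_bounds hD hb h0.le h1 (by linarith [hr.1] : 1 ≤ r)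
    have em := cut_mem h.hf ε r
    have ef := h.hf.2.2.2.2 (r * t ^ (-α))
    have s0 : 0 < t ^ (-α) := by positivity
    have s1 : t ^ (-α) ≤ 1 := rpow_le_one_of_one_le_of_nonpos ht (by linarith [h.hα])
    have f1 := mono_deriv_nonneg h.hf.2.1 (r * t ^ (-α))
    have hjw : t⁻¹ * |a (t, r) * dR b (t, r) - b (t, r) * dR a (t, r)| ≤
        t ^ (-α) * dP a b t r + t ^ (α - 2) * dS a b t r := by
      have := real_ineq3 (a (t, r)) (b (t, r)) (dR a (t, r)) (dR b (t, r))
        (s := t ^ (1 - α)) (by positivity)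
      have q1 : t⁻¹ * t ^ (1 - α) = t ^ (-α) := by
        rw [← rpow_neg_one, ← rpow_add t0]; congr 1; ring
      have q2 : t⁻¹ * (t ^ (1 - α))⁻¹ = t ^ (α - 2) := by
        rw [← rpow_neg_one, ← rpow_neg t0.le, ← rpow_add t0]; congr 1; ring
      calc _ ≤ t⁻¹ * (t ^ (1 - α) * (dR a (t, r) ^ 2 + dR b (t, r) ^ 2)
            + (t ^ (1 - α))⁻¹ * (a (t, r) ^ 2 + b (t, r) ^ 2)) := by gcongr
        _ = (t⁻¹ * t ^ (1 - α)) * dP a b t r + (t⁻¹ * (t ^ (1 - α))⁻¹) * dS a b t r := by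
            unfold dP dS; ring
        _ = _ := by rw [q1, q2]
    have hρ : deriv f (r * t ^ (-α)) * (r * t ^ (-α)) ≤ deriv f (r * t ^ (-α)) := by
      by_cases hx : r * t ^ (-α) ≤ 1
      · exact mul_le_of_le_one_right f1 hx
      · rw [(char_out1 h.hf).2 _ (not_le.1 hx)]; simp
    have PA := pointwise_alg (S := dS a b t r) (P := dP a b t r)
      (j := a (t, r) * dR b (t, r) - b (t, r) * dR a (t, r))
      (q := a (t, r) * dR a (t, r) + b (t, r) * dR b (t, r))
      (X := cut f ε r) (f0 := f (r * t ^ (-α))) (f1 := deriv f (r * t ^ (-α))) (n := n t r)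
      (W3 := Wt3 f α ε (t, r)) (x1 := cut1 f ε r) (D := D) (C := C₀ * t ^ (-β₀)) (ε := ε)
      (ρ := r * t ^ (-α)) (s := t ^ (-α)) (ti := t⁻¹) (τ := t ^ (α - 2))
      (E1 := D * t ^ (-(3 * α))) (α := α)
      (by unfold dS; positivity) (by unfold dP; positivity) (real_ineq2 _ _ _ _) hjw em.1 em.2 f1
      ((le_abs_self _).trans (hb _).1) ec.2.1 ef.1 ef.2 h0.le h1 s0.le s1 (by positivity)
      (by positivity) hD hρ (by positivity) (h.n1 t r ht hr.1) (h.n2 t r ht hr.1)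
      (Wt3_bound h.hf hD hb h0.le h1 (by linarith [hr.1]) ht (by linarith [h.hα]))
      (by linarith [h.hα]) h.hα1.le (by positivity)
    have eY : Y (t, r) = cut f ε r * (deriv f (r * t ^ (-α)) * (-α * (r * t ^ (-α)) * t⁻¹))
        * (a (t, r) * dR b (t, r) - b (t, r) * dR a (t, r))
        + 2 * (cut1 f ε r * f (r * t ^ (-α)) + cut f ε r * (deriv f (r * t ^ (-α)) * t ^ (-α)))
          * dP a b t r - 1 / 2 * Wt3 f α ε (t, r) * dS a b t r
      + n t r * (cut1 f ε r * f (r * t ^ (-α)) + cut f ε r * (deriv f (r * t ^ (-α)) * t ^ (-α)))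
        * dS a b t r
      + 2 * (n t r * (cut f ε r * f (r * t ^ (-α))))
        * (a (t, r) * dR a (t, r) + b (t, r) * dR b (t, r)) := by
      simp only [hYdef, dRRR_Wt h.hf α ε _ p0, dR_Wt h.hf α ε _ p0, dT_Wt h.hf α ε t0 r0, Wt1, Wt,
        wgt, dS, dP]
      ring
    rw [eY]
    refine le_trans ?_ PA
    have hSP : 0 ≤ dS a b t r + dP a b t r := by unfold dS dP; positivity
    refine mul_le_mul_of_nonneg_right ?_ hSP
    have x1 : t ^ (α - 2) ≤ t ^ (-1 - δ) := rpow_le_rpow_of_exponent_le ht d1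
    have x2 : t ^ (-(3 * α)) ≤ t ^ (-1 - δ) := rpow_le_rpow_of_exponent_le ht d2
    have x3 : t ^ (-β₀) ≤ t ^ (-1 - δ) := rpow_le_rpow_of_exponent_le ht d3
    have y1 : D * t ^ (α - 2) ≤ D * t ^ (-1 - δ) := by gcongr
    have y2 : D * t ^ (-(3 * α)) ≤ D * t ^ (-1 - δ) := by gcongr
    have y3 : (2 + D) * (C₀ * t ^ (-β₀)) ≤ (2 + D) * (C₀ * t ^ (-1 - δ)) := by gcongr
    rw [hκ]
    linarith
  have hmono := intervalIntegral.integral_mono_on hd (bi.const_mul (-κ)) key.1 pw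
  refine le_trans ?_ hmono
  rw [intervalIntegral.integral_const_mul]
  nlinarith

lemma Data1.mass_deriv (h : Data1 a b n f α β₀ M C₀) {D : ℝ} (hD : 1 ≤ D)
    (hb : ∀ x, |deriv f x| ≤ D ∧ |deriv (deriv f) x| ≤ D ∧ |deriv (deriv (deriv f)) x| ≤ D)
    {ε t : ℝ} (h0 : 0 < ε) (h1 : ε ≤ 1) (ht : 1 ≤ t) (ht2 : 2 * t ^ (-α) < 1 / 2) :
    ∃ y, HasDerivAt (MasE a b f α ε) y t ∧
      |y - 2 * GamE a b f α ε t| ≤ (t ^ (α - 1) + D * ε) * M := by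
  have t0 : 0 < t := by linarith
  have hd := two_le_exp h0 h1
  have hd0 : 0 < exp (2 / ε) := exp_pos _
  have hK := sm_Kt h.hf α ε
  have hW := sm_Wt h.hf α ε
  have ha := h.sa
  have hb' := h.sb
  have hA : SmQ (fun p => Kt f α ε p * (a p * a p + b p * b p)) :=
    hK.mul ((ha.mul ha).add (hb'.mul hb'))
  have hB : SmQ (fun p => (-2) * (Kt f α ε p * (a p * dR b p - b p * dR a p))) :=
    (SmQ.const _).mul (hK.mul ((ha.mul hb'.dR).sub (hb'.mul ha.dR)))
  set Y : ℝ × ℝ → ℝ := fun p => dT (Kt f α ε) p * (a p ^ 2 + b p ^ 2)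
      + 2 * dR (Kt f α ε) p * (a p * dR b p - b p * dR a p) with hYdef
  have key := hA.leibniz_sub hB (Y := Y) t0 (c := 2) (d := exp (2 / ε)) (by norm_num) hd
    (by
      have z0 : prim f (2 * t ^ (-α)) = 0 := prim_zero h.hf (by positivity) ht2.le
      simp [Kt, z0])
    (by
      have : 1 < ε * log (exp (2 / ε)) := by
        rw [log_exp, mul_div_cancel₀ _ h0.ne']; norm_num
      obtain ⟨z0, z1, z2⟩ := cut_vanish h.hf this
      simp only [Kt, z0]
      ring)
    (fun r hr => core_mass ha hb' hK t0 hr (h.e1 t r t0 hr) (h.e2 t r t0 hr))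
  refine ⟨∫ r in (2 : ℝ)..exp (2 / ε), Y (t, r), ?_, ?_⟩
  · have e : MasE a b f α ε = fun s => ∫ r in (2 : ℝ)..exp (2 / ε),
        (fun p => Kt f α ε p * (a p * a p + b p * b p)) (s, r) := by
      funext s
      unfold MasE dS
      simp only [pow_two]
    rw [e]
    exact key.2
  obtain ⟨bi, bM⟩ := h.bd ht hd
  have iW : IntervalIntegrable (fun r => Wt f α ε (t, r) * dJ a b t r) volume 2 (exp (2 / ε)) :=
    (hW.mul ((ha.mul hb'.dR).sub (hb'.mul ha.dR))).intervalIntegrable t0 (by norm_num) hd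
  unfold GamE
  rw [← intervalIntegral.integral_const_mul, ← intervalIntegral.integral_sub key.1 (iW.const_mul 2)]
  have pw : ∀ r ∈ Set.Icc 2 (exp (2 / ε)), |Y (t, r) - 2 * (Wt f α ε (t, r) * dJ a b t r)| ≤
      (t ^ (α - 1) + D * ε) * (dS a b t r + dP a b t r) := by
    intro r hr
    have r0 : 0 < r := by linarith [hr.1]
    have k1 := dT_Kt h.hf (ε := ε) (by linarith [h.hα]) h.hα1.le t0 r0
    have k2 := dR_Kt h.hf (α := α) hD hb h0.le h1 (by linarith [hr.1] : 1 ≤ r) t0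
    have k3 := real_ineq1 (a (t, r)) (b (t, r)) (dR a (t, r)) (dR b (t, r))
    have e : Y (t, r) - 2 * (Wt f α ε (t, r) * dJ a b t r) = dT (Kt f α ε) (t, r) * dS a b t r
        + 2 * ((dR (Kt f α ε) (t, r) - Wt f α ε (t, r)) * dJ a b t r) := by
      simp only [hYdef, dS, dJ]; ring
    have hS : 0 ≤ dS a b t r := by unfold dS; positivity
    have hP : 0 ≤ dP a b t r := by unfold dP; positivity
    have l1 : |dT (Kt f α ε) (t, r) * dS a b t r| ≤ t ^ (α - 1) * dS a b t r := by
      rw [abs_mul, abs_of_nonneg hS]; gcongr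
    have l2 : |(dR (Kt f α ε) (t, r) - Wt f α ε (t, r)) * dJ a b t r| ≤
        D * ε * ((dS a b t r + dP a b t r) / 2) := by
      rw [abs_mul]
      exact mul_le_mul k2 k3 (abs_nonneg _) (by positivity)
    rw [e]
    have hT : 0 ≤ t ^ (α - 1) * dP a b t r := by positivity
    refine (abs_add_le _ _).trans ?_
    rw [abs_mul 2, abs_two]
    nlinarith
  have := intervalIntegral.abs_integral_le_integral_abs (μ := volume)
    (f := fun r => Y (t, r) - 2 * (Wt f α ε (t, r) * dJ a b t r)) hd
  refine this.trans ?_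
  have i5 := (key.1.sub (iW.const_mul 2)).abs
  refine (intervalIntegral.integral_mono_on hd i5 (bi.const_mul (t ^ (α - 1) + D * ε)) pw).trans ?_
  rw [intervalIntegral.integral_const_mul]
  gcongr
end trunc

lemma mono_of_hasDeriv {q : ℝ → ℝ} {s : ℝ}
    (h : ∀ t, s ≤ t → ∃ y, HasDerivAt q y t ∧ 0 ≤ y) {t1 T : ℝ} (h1 : s ≤ t1) (h2 : t1 ≤ T) :
    q t1 ≤ q T := by
  have hm : MonotoneOn q (Set.Ici s) := by
    refine monotoneOn_of_deriv_nonneg (convex_Ici s) ?_ ?_ ?_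
    · intro x hx
      obtain ⟨y, hy, -⟩ := h x hx
      exact hy.continuousAt.continuousWithinAt
    · intro x hx
      obtain ⟨y, hy, -⟩ := h x (interior_subset hx)
      exact hy.differentiableAt.differentiableWithinAt
    · intro x hx
      obtain ⟨y, hy, hy0⟩ := h x (interior_subset hx)
      rw [hy.deriv]; exact hy0
  exact hm h1 (h1.trans h2) h2

lemma mono_of_hasDeriv' {q : ℝ → ℝ} {t1 T : ℝ} (h2 : t1 ≤ T)
    (h : ∀ t, t1 ≤ t → t ≤ T → ∃ y, HasDerivAt q y t ∧ 0 ≤ y) :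
    q t1 ≤ q T := by
  have hm : MonotoneOn q (Set.Icc t1 T) := by
    refine monotoneOn_of_deriv_nonneg (convex_Icc t1 T) ?_ ?_ ?_
    · intro x hx
      obtain ⟨y, hy, -⟩ := h x hx.1 hx.2
      exact hy.continuousAt.continuousWithinAt
    · intro x hx
      have hx := interior_subset hx
      obtain ⟨y, hy, -⟩ := h x hx.1 hx.2
      exact hy.differentiableAt.differentiableWithinAt
    · intro x hx
      have hx := interior_subset hx
      obtain ⟨y, hy, hy0⟩ := h x hx.1 hx.2
      rw [hy.deriv]; exact hy0
  exact hm ⟨le_rfl, h2⟩ ⟨h2, le_rfl⟩ h2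

lemma two_sided {G Q : ℝ → ℝ} {c1 c2 δ α η s : ℝ} (hs : 1 ≤ s) (hδ : 0 < δ) (hα : 0 < α)
    (hη : 0 ≤ η) (hc1 : 0 ≤ c1) (hc2 : 0 ≤ c2)
    (hG : ∀ t, s ≤ t → ∃ y, HasDerivAt G y t ∧ -(c1 * t ^ (-1 - δ) + η) ≤ y)
    (hQ : ∀ t, s ≤ t → ∃ y, HasDerivAt Q y t ∧ |y - 2 * G t| ≤ c2 * t ^ (α - 1) + η)
    {t1 T : ℝ} (h1 : s ≤ t1) (h2 : t1 ≤ T) :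
    2 * (G t1 - c1 / δ * t1 ^ (-δ) - η * T) * (T - t1) - c2 / α * T ^ α - η * T ≤ Q T - Q t1 ∧
    Q T - Q t1 ≤ 2 * (G T + c1 / δ * t1 ^ (-δ) + η * T) * (T - t1) + c2 / α * T ^ α + η * T := by
  have hm : ∀ x y, s ≤ x → x ≤ y → G x - c1 / δ * x ^ (-δ) + η * x ≤
      G y - c1 / δ * y ^ (-δ) + η * y := by
    intro x y hx hxy
    refine mono_of_hasDeriv (q := fun x => G x - c1 / δ * x ^ (-δ) + η * x) (s := s) ?_ hx hxy
    intro t ht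
    have t0 : 0 < t := by linarith
    obtain ⟨y, hy, hy0⟩ := hG t ht
    refine ⟨_, (hy.sub ((Real.hasDerivAt_rpow_const (p := -δ) (Or.inl t0.ne')).const_mul
      (c1 / δ))).add ((hasDerivAt_id t).const_mul η), ?_⟩
    have e : -δ - 1 = -1 - δ := by ring
    rw [e]
    have : c1 / δ * (-δ * t ^ (-1 - δ)) = -(c1 * t ^ (-1 - δ)) := by field_simp
    rw [this]
    linarith
  have t10 : 0 < t1 := by linarith
  have hp : ∀ t, t1 ≤ t → 0 ≤ c1 / δ * t ^ (-δ) ∧ c1 / δ * t ^ (-δ) ≤ c1 / δ * t1 ^ (-δ) := by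
    intro t ht
    have t0 : 0 < t := by linarith
    constructor
    · positivity
    · have : t ^ (-δ) ≤ t1 ^ (-δ) := rpow_le_rpow_of_nonpos t10 ht (by linarith)
      gcongr
  have hpα : 0 ≤ c2 / α * t1 ^ α := by positivity
  have hηt : 0 ≤ η * t1 := by positivity
  constructor
  · set L := G t1 - c1 / δ * t1 ^ (-δ) - η * T with hL
    have := mono_of_hasDeriv' (q := fun x => Q x - 2 * L * x + c2 / α * x ^ α + η * x) h2 (by
      intro t ht htT
      have t0 : 0 < t := by linarith
      obtain ⟨y, hy, hy0⟩ := hQ t (h1.trans ht)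
      refine ⟨_, ((hy.sub ((hasDerivAt_id t).const_mul (2 * L))).add
        ((Real.hasDerivAt_rpow_const (p := α) (Or.inl t0.ne')).const_mul
        (c2 / α))).add ((hasDerivAt_id t).const_mul η), ?_⟩
      have e : c2 / α * (α * t ^ (α - 1)) = c2 * t ^ (α - 1) := by field_simp
      rw [e]
      have k1 := hm t1 t h1 ht
      have k2 := (hp t ht).1
      have k3 := (abs_le.1 hy0).1
      have k4 : η * t ≤ η * T := by gcongr
      linarith)
    linarith
  · set U := G T + c1 / δ * t1 ^ (-δ) + η * T with hU
    have := mono_of_hasDeriv' (q := fun x => 2 * U * x + c2 / α * x ^ α + η * x - Q x) h2 (by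
      intro t ht htT
      have t0 : 0 < t := by linarith
      obtain ⟨y, hy, hy0⟩ := hQ t (h1.trans ht)
      refine ⟨_, ((((hasDerivAt_id t).const_mul (2 * U)).add
        ((Real.hasDerivAt_rpow_const (p := α) (Or.inl t0.ne')).const_mul
        (c2 / α))).add ((hasDerivAt_id t).const_mul η)).sub hy, ?_⟩
      have e : c2 / α * (α * t ^ (α - 1)) = c2 * t ^ (α - 1) := by field_simp
      rw [e]
      have k1 := hm t T (h1.trans ht) htT
      have k2 := (hp t ht).2
      have k2' := (hp T h2).1
      have k3 := (abs_le.1 hy0).2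
      have k4 : 0 ≤ η * t := by positivity
      linarith)
    linarith

lemma final_limit {G Q : ℝ → ℝ} {c1 c2 δ α s : ℝ} (hs : 1 ≤ s) (hδ : 0 < δ)
    (hα1 : α < 1)
    (h : ∀ t1 T, s ≤ t1 → t1 ≤ T →
      2 * (G t1 - c1 * t1 ^ (-δ)) * (T - t1) - c2 * T ^ α ≤ Q T - Q t1 ∧
      Q T - Q t1 ≤ 2 * (G T + c1 * t1 ^ (-δ)) * (T - t1) + c2 * T ^ α)
    (hQ : Tendsto (fun T => Q T / T) atTop (𝓝 0)) : Tendsto G atTop (𝓝 0) := by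
  have hTα : Tendsto (fun T : ℝ => c2 * (T ^ α / T)) atTop (𝓝 0) := by
    have : Tendsto (fun T : ℝ => c2 * T ^ (-(1 - α))) atTop (𝓝 (c2 * 0)) :=
      (tendsto_rpow_neg_atTop (by linarith)).const_mul c2
    rw [mul_zero] at this
    refine this.congr' ?_
    filter_upwards [eventually_gt_atTop 0] with T hT
    rw [← rpow_sub_one hT.ne']
    congr 2; ring
  have hc : ∀ c : ℝ, Tendsto (fun T : ℝ => c / T) atTop (𝓝 0) := fun c =>
    tendsto_const_nhds.div_atTop tendsto_id
  have hdec : Tendsto (fun t : ℝ => c1 * t ^ (-δ)) atTop (𝓝 0) := by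
    have := (tendsto_rpow_neg_atTop hδ).const_mul c1
    rwa [mul_zero] at this
  have up : ∀ t1, s ≤ t1 → G t1 ≤ c1 * t1 ^ (-δ) := by
    intro t1 h1
    have l1 : Tendsto (fun T => Q T / T - Q t1 / T + c2 * (T ^ α / T)) atTop (𝓝 (0 - 0 + 0)) :=
      (hQ.sub (hc _)).add hTα
    have l2 : Tendsto (fun T => 2 * (G t1 - c1 * t1 ^ (-δ)) * (1 - t1 / T)) atTop
        (𝓝 (2 * (G t1 - c1 * t1 ^ (-δ)) * (1 - 0))) :=
      (tendsto_const_nhds.sub (hc t1)).const_mul _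
    have : 2 * (G t1 - c1 * t1 ^ (-δ)) * (1 - 0) ≤ 0 - 0 + 0 := by
      refine le_of_tendsto_of_tendsto l2 l1 ?_
      filter_upwards [eventually_ge_atTop t1] with T hT
      have T0 : 0 < T := by linarith
      have := (h t1 T h1 hT).1
      have e1 : 2 * (G t1 - c1 * t1 ^ (-δ)) * (1 - t1 / T) =
        (2 * (G t1 - c1 * t1 ^ (-δ)) * (T - t1)) / T := by field_simp
      have e2 : Q T / T - Q t1 / T + c2 * (T ^ α / T) = (Q T - Q t1 + c2 * T ^ α) / T := by ring
      rw [e1, e2]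
      gcongr
      linarith
    linarith
  rw [Metric.tendsto_atTop]
  intro κ hκ
  obtain ⟨t2, ht2⟩ := (Metric.tendsto_atTop.1 hdec) (κ / 2) (by positivity)
  set t1 := max s t2 with ht1
  have l1 : Tendsto (fun T => (Q T / T - Q t1 / T - c2 * (T ^ α / T))
      - κ * (t1 / T)) atTop (𝓝 ((0 - 0 - 0) - κ * 0)) :=
    ((hQ.sub (hc _)).sub hTα).sub ((hc t1).const_mul _)
  have l1' := l1.eventually_const_lt (show -κ < (0 - 0 - 0) - κ * 0 by linarith)
  obtain ⟨N, hN⟩ := eventually_atTop.1 l1'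
  have b1 := ht2 t1 (le_max_right _ _)
  rw [Real.dist_eq, sub_zero] at b1
  have b1' := (abs_lt.1 b1).2
  refine ⟨max (t1 + 1) N, fun T hT => ?_⟩
  have hT1 : t1 + 1 ≤ T := (le_max_left _ _).trans hT
  have hsT : s ≤ T := by linarith [le_max_left s t2]
  have T0 : 0 < T := by linarith
  have u := up T hsT
  have b2 := ht2 T (by linarith [le_max_right s t2])
  rw [Real.dist_eq, sub_zero] at b2
  have b2' := (abs_lt.1 b2).2
  have v := (h t1 T (le_max_left _ _) (by linarith)).2
  have w := hN T ((le_max_right _ _).trans hT)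
  rw [Real.dist_eq, sub_zero, abs_lt]
  constructor
  · by_contra hcon
    push Not at hcon
    have e2 : (Q T / T - Q t1 / T - c2 * (T ^ α / T)) - κ * (t1 / T) =
        ((Q T - Q t1 - c2 * T ^ α) - κ * t1) / T := by ring
    rw [e2, lt_div_iff₀ T0] at w
    have : 2 * (G T + c1 * t1 ^ (-δ)) ≤ -κ := by linarith
    have : 2 * (G T + c1 * t1 ^ (-δ)) * (T - t1) ≤ -κ * (T - t1) := by
      apply mul_le_mul_of_nonneg_right this; linarith
    nlinarith
  · linarith

section lim
variable {a b : ℝ × ℝ → ℝ} {n : ℝ → ℝ → ℝ} {f : ℝ → ℝ} {α β₀ M C₀ : ℝ}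

lemma cut_tendsto (hf : IsSmoothChar f) (r : ℝ) :
    Tendsto (fun k : ℕ => cut f (1 / ((k : ℝ) + 1)) r) atTop (𝓝 1) := by
  have h1 : Tendsto (fun k : ℕ => (1 / ((k : ℝ) + 1)) * log r) atTop (𝓝 (0 * log r)) :=
    tendsto_one_div_add_atTop_nhds_zero_nat.mul_const _
  have h2 := (hf.1.continuous.tendsto (0 * log r)).comp h1
  have : f (0 * log r) = 0 := hf.2.2.1 _ (by norm_num)
  rw [this] at h2
  simpa [cut, Function.comp_def] using h2.const_sub 1

lemma trunc_tendsto (hf : IsSmoothChar f) {w v : ℝ → ℝ} (hw : IntegrableOn w (Set.Ioi 2))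
    (hv : ∀ r ∈ Set.Ioi (2 : ℝ), v r = w r) :
    Tendsto (fun k : ℕ => ∫ r in (2 : ℝ)..exp (2 / (1 / ((k : ℝ) + 1))),
      cut f (1 / ((k : ℝ) + 1)) r * v r) atTop (𝓝 (∫ r in Set.Ioi 2, w r)) := by
  have e : ∀ k : ℕ, ∫ r in (2 : ℝ)..exp (2 / (1 / ((k : ℝ) + 1))),
      cut f (1 / ((k : ℝ) + 1)) r * v r = ∫ r in Set.Ioi 2, cut f (1 / ((k : ℝ) + 1)) r * w r := by
    intro k
    set ε : ℝ := 1 / ((k : ℝ) + 1) with hε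
    have h0 : 0 < ε := by positivity
    have h1 : ε ≤ 1 := by
      rw [hε, div_le_one (by positivity)]
      have : (0 : ℝ) ≤ k := by positivity
      linarith
    have hd := two_le_exp h0 h1
    rw [intervalIntegral.integral_of_le hd]
    symm
    have : ∫ r in Set.Ioc 2 (exp (2 / ε)), cut f ε r * v r =
        ∫ r in Set.Ioc 2 (exp (2 / ε)), cut f ε r * w r := by
      refine setIntegral_congr_fun measurableSet_Ioc fun r hr => ?_
      simp only [hv r hr.1]
    rw [this]
    refine setIntegral_eq_of_subset_of_forall_sdiff_eq_zero measurableSet_Ioi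
      Set.Ioc_subset_Ioi_self ?_
    intro r hr
    have hr1 : 2 < r := hr.1
    have hr2 : exp (2 / ε) < r := by
      by_contra hcon
      exact hr.2 ⟨hr1, not_lt.1 hcon⟩
    have : 1 < ε * log r := by
      have := Real.log_lt_log (exp_pos _) hr2
      rw [log_exp, div_lt_iff₀ h0] at this
      linarith
    simp [(cut_vanish hf this).1]
  simp only [e]
  refine tendsto_integral_of_dominated_convergence (fun r => ‖w r‖) ?_ hw.norm ?_ ?_
  · intro k
    refine AEStronglyMeasurable.mul ?_ hw.aestronglyMeasurable
    have : Measurable (cut f (1 / ((k : ℝ) + 1))) := by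
      unfold cut
      exact measurable_const.sub (hf.1.continuous.measurable.comp
        (measurable_const.mul Real.measurable_log))
    exact this.aestronglyMeasurable
  · intro k
    refine Eventually.of_forall fun r => ?_
    have c := cut_mem hf (1 / ((k : ℝ) + 1)) r
    rw [norm_mul, Real.norm_of_nonneg c.1]
    exact mul_le_of_le_one_left (norm_nonneg _) c.2
  · refine Eventually.of_forall fun r => ?_
    simpa using (cut_tendsto hf r).mul_const (w r)

lemma sm_slice_meas {A : ℝ × ℝ → ℝ} (hA : SmQ A) {t : ℝ} (ht : 0 < t) :
    AEStronglyMeasurable (fun r => A (t, r)) (volume.restrict (Set.Ioi 2)) :=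
  ((hA.contOn_slice ht).mono (Set.Ioi_subset_Ioi (by norm_num))).aestronglyMeasurable
    measurableSet_Ioi

/-- One-dimensional conclusion. -/
lemma Data1.main (h : Data1 a b n f α β₀ M C₀)
    (hsub : Tendsto (fun t => (∫ r in Set.Ioi 2, r * (a (t, r) ^ 2 + b (t, r) ^ 2)) / t)
      atTop (𝓝 0)) :
    Tendsto (fun t => ∫ r in Set.Ioi 2, f (r * t ^ (-α)) * dJ a b t r) atTop (𝓝 0) := by
  obtain ⟨D, hD, hb⟩ := char_bounds h.hf
  have hα := h.hα
  have hα1 := h.hα1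
  have hβ := h.hβ
  have hC := h.hC
  obtain ⟨δ, hδ, d1, d2, d3⟩ : ∃ δ : ℝ, 0 < δ ∧ α - 2 ≤ -1 - δ ∧ -(3 * α) ≤ -1 - δ ∧
      -β₀ ≤ -1 - δ := by
    refine ⟨min (1 - α) (min (3 * α - 1) (β₀ - 1)), ?_, ?_, ?_, ?_⟩
    · simp only [lt_min_iff]; refine ⟨?_, ?_, ?_⟩ <;> linarith
    · linarith [min_le_left (1 - α) (min (3 * α - 1) (β₀ - 1))]
    · linarith [min_le_right (1 - α) (min (3 * α - 1) (β₀ - 1)),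
        min_le_left (3 * α - 1) (β₀ - 1)]
    · linarith [min_le_right (1 - α) (min (3 * α - 1) (β₀ - 1)),
        min_le_right (3 * α - 1) (β₀ - 1)]
  have hlim : Tendsto (fun t : ℝ => 2 * t ^ (-α)) atTop (𝓝 (2 * 0)) :=
    (tendsto_rpow_neg_atTop (by linarith)).const_mul 2
  obtain ⟨s0, hs0⟩ := eventually_atTop.1
    (hlim.eventually_lt_const (show (2 : ℝ) * 0 < 1 / 2 by norm_num))
  set s := max 1 s0 with hsdef
  have hs1 : 1 ≤ s := le_max_left _ _
  have hM0 : 0 ≤ M := by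
    refine le_trans ?_ (h.hM 1 le_rfl)
    refine add_nonneg (integral_nonneg fun r => ?_) (integral_nonneg fun r => ?_)
    · exact add_nonneg (sq_nonneg _) (sq_nonneg _)
    · exact add_nonneg (sq_nonneg _) (sq_nonneg _)
  set G : ℝ → ℝ := fun t => ∫ r in Set.Ioi 2, f (r * t ^ (-α)) * dJ a b t r with hG
  set Q : ℝ → ℝ := fun t => ∫ r in Set.Ioi 2,
    (t ^ α * prim f (r * t ^ (-α))) * dS a b t r with hQ
  have sJ : SmQ (fun p => a p * dR b p - b p * dR a p) :=
    (h.sa.mul h.sb.dR).sub (h.sb.mul h.sa.dR)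
  have sS : SmQ (fun p => a p ^ 2 + b p ^ 2) :=
    ((h.sa.mul h.sa).add (h.sb.mul h.sb)).congr (fun p _ => by simp [pow_two])
  have swg : SmQ (fun p => f (p.2 * p.1 ^ (-α))) :=
    sm_comp h.hf.1 (sm_snd.mul (sm_rpow (-α)))
  have spr : SmQ (fun p => p.1 ^ α * prim f (p.2 * p.1 ^ (-α))) :=
    (sm_rpow α).mul (sm_comp (prim_contDiff h.hf) (sm_snd.mul (sm_rpow (-α))))
  have prb : ∀ t r : ℝ, 0 < t → 0 < r → 0 ≤ t ^ α * prim f (r * t ^ (-α)) ∧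
      t ^ α * prim f (r * t ^ (-α)) ≤ r := by
    intro t r ht hr
    have tt : t ^ α * t ^ (-α) = 1 := by rw [← rpow_add ht]; simp
    have p0 := prim_nonneg h.hf (x := r * t ^ (-α)) (by positivity)
    have p1 := prim_le h.hf (x := r * t ^ (-α)) (by positivity)
    refine ⟨by positivity, ?_⟩
    calc _ ≤ t ^ α * (r * t ^ (-α)) := by gcongr
      _ = r * (t ^ α * t ^ (-α)) := by ring
      _ = r := by rw [tt, mul_one]
  have iG : ∀ t, 1 ≤ t → IntegrableOn (fun r => f (r * t ^ (-α)) * dJ a b t r) (Set.Ioi 2) := by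
    intro t ht
    have t0 : 0 < t := by linarith
    refine Integrable.mono' ((h.iS t ht).add (h.iP t ht)) (sm_slice_meas (swg.mul sJ) t0) ?_
    refine Eventually.of_forall fun r => ?_
    have k := real_ineq1 (a (t, r)) (b (t, r)) (dR a (t, r)) (dR b (t, r))
    have c := h.hf.2.2.2.2 (r * t ^ (-α))
    rw [norm_mul, Real.norm_of_nonneg c.1]
    refine (mul_le_of_le_one_left (norm_nonneg _) c.2).trans (k.trans ?_)
    simp only [Pi.add_apply]
    have : 0 ≤ (a (t, r) ^ 2 + b (t, r) ^ 2) + (dR a (t, r) ^ 2 + dR b (t, r) ^ 2) := by positivity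
    linarith
  have iQ : ∀ t, 1 ≤ t → IntegrableOn (fun r => (t ^ α * prim f (r * t ^ (-α))) * dS a b t r)
      (Set.Ioi 2) := by
    intro t ht
    have t0 : 0 < t := by linarith
    refine Integrable.mono' (h.iR t ht) (sm_slice_meas (spr.mul sS) t0) ?_
    filter_upwards [ae_restrict_mem measurableSet_Ioi] with r hr
    have r0 : 0 < r := by
      have : 2 < r := hr
      linarith
    have hS : 0 ≤ dS a b t r := by unfold dS; positivity
    have p := prb t r t0 r0
    rw [Real.norm_of_nonneg (mul_nonneg p.1 hS)]
    exact mul_le_mul_of_nonneg_right p.2 hS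
  have tG : ∀ t, 1 ≤ t → Tendsto (fun k : ℕ => GamE a b f α (1 / ((k : ℝ) + 1)) t) atTop
      (𝓝 (G t)) := by
    intro t ht
    have := trunc_tendsto h.hf (iG t ht) (fun r _ => rfl)
    refine this.congr fun k => ?_
    unfold GamE Wt wgt
    simp only [mul_assoc]
  have tQ : ∀ t, 1 ≤ t → Tendsto (fun k : ℕ => MasE a b f α (1 / ((k : ℝ) + 1)) t) atTop
      (𝓝 (Q t)) := by
    intro t ht
    have := trunc_tendsto h.hf (iQ t ht) (fun r _ => rfl)
    refine this.congr fun k => ?_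
    unfold MasE Kt
    simp only [mul_assoc]
  set c1 : ℝ := (2 * D + (2 + D) * C₀) * M with hc1
  have hc10 : 0 ≤ c1 := by positivity
  have te : Tendsto (fun k : ℕ => 10 * D ^ 2 * (1 / ((k : ℝ) + 1)) * M) atTop (𝓝 0) := by
    have := (tendsto_one_div_add_atTop_nhds_zero_nat (𝕜 := ℝ)).const_mul (10 * D ^ 2)
    simpa using this.mul_const M
  refine final_limit (G := G) (Q := Q) (c1 := c1 / δ) (c2 := M / α) (δ := δ) (α := α) hs1 hδ
    hα1 ?_ ?_
  · intro t1 T h1 h2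
    have ht1 : 1 ≤ t1 := hs1.trans h1
    have hT : 1 ≤ T := ht1.trans h2
    have main : ∀ k : ℕ, _ := fun k => by
      have e0 : 0 < (1 / ((k : ℝ) + 1)) := by positivity
      have e1 : (1 / ((k : ℝ) + 1)) ≤ 1 := by
        rw [div_le_one (by positivity)]
        have : (0 : ℝ) ≤ k := by positivity
        linarith
      exact two_sided (G := GamE a b f α (1 / ((k : ℝ) + 1))) (Q := MasE a b f α (1 / ((k : ℝ) + 1)))
        (c1 := c1) (c2 := M) (δ := δ) (α := α) (η := 10 * D ^ 2 * (1 / ((k : ℝ) + 1)) * M) (s := s)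
        hs1 hδ (by linarith) (by positivity) hc10 hM0
        (by
          intro t ht
          have ht' : 1 ≤ t := hs1.trans ht
          obtain ⟨y, hy, hy1⟩ := h.mom_deriv hD hb d1 d2 d3 e0 e1 ht'
            (hs0 t ((le_max_right _ _).trans ht))
          refine ⟨y, hy, le_trans (le_of_eq ?_) hy1⟩
          rw [hc1]; ring)
        (by
          intro t ht
          have ht' : 1 ≤ t := hs1.trans ht
          obtain ⟨y, hy, hy1⟩ := h.mass_deriv hD hb e0 e1 ht'
            (hs0 t ((le_max_right _ _).trans ht))
          refine ⟨y, hy, hy1.trans ?_⟩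
          have : D * (1 / ((k : ℝ) + 1)) * M ≤ 10 * D ^ 2 * (1 / ((k : ℝ) + 1)) * M := by
            gcongr; nlinarith
          linarith)
        h1 h2
    have q := (tQ T hT).sub (tQ t1 ht1)
    constructor
    · have l := ((((((tG t1 ht1).sub_const (c1 / δ * t1 ^ (-δ))).sub (te.mul_const T)).const_mul
        2).mul_const (T - t1)).sub_const (M / α * T ^ α)).sub (te.mul_const T)
      have := le_of_tendsto_of_tendsto' l q fun k => (main k).1
      simpa using this
    · have l := ((((((tG T hT).add_const (c1 / δ * t1 ^ (-δ))).add (te.mul_const T)).const_mul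
        2).mul_const (T - t1)).add_const (M / α * T ^ α)).add (te.mul_const T)
      have := le_of_tendsto_of_tendsto' q l fun k => (main k).2
      simpa using this
  · refine squeeze_zero' ?_ ?_ hsub
    · filter_upwards [eventually_ge_atTop 1] with t ht
      have t0 : 0 < t := by linarith
      refine div_nonneg (setIntegral_nonneg measurableSet_Ioi fun r hr => ?_) t0.le
      have r0 : 0 < r := by
        have : 2 < r := hr
        linarith
      have hS : 0 ≤ dS a b t r := by unfold dS; positivity
      exact mul_nonneg (prb t r t0 r0).1 hS
    · filter_upwards [eventually_ge_atTop 1] with t ht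
      have t0 : 0 < t := by linarith
      gcongr
      refine setIntegral_mono_on (iQ t ht) (h.iR t ht) measurableSet_Ioi fun r hr => ?_
      have r0 : 0 < r := by
        have : 2 < r := hr
        linarith
      have hS : 0 ≤ dS a b t r := by unfold dS; positivity
      exact mul_le_mul_of_nonneg_right (prb t r t0 r0).2 hS
end lim

/-- The first unit vector. -/
def ev : R3 := EuclideanSpace.single 0 1

lemma norm_ev : ‖ev‖ = 1 := by simp [ev]

lemma norm_smul_ev {r : ℝ} (hr : 0 ≤ r) : ‖r • ev‖ = r := by
  rw [norm_smul, norm_ev, Real.norm_of_nonneg hr, mul_one]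

/-- Radial profile. -/
def prof (ψ : R3 → ℂ) (r : ℝ) : ℂ := ψ (r • ev)

lemma hasFDerivAt_nrm {x : R3} (hx : x ≠ 0) :
    HasFDerivAt (fun y : R3 => ‖y‖) (‖x‖⁻¹ • innerSL ℝ x) x := by
  have hn : 0 < ‖x‖ := norm_pos_iff.2 hx
  have h1 : HasFDerivAt (fun y : R3 => ‖y‖ ^ 2) (2 • innerSL ℝ x) x :=
    (hasStrictFDerivAt_norm_sq x).hasFDerivAt
  have h2 := h1.sqrt (by positivity)
  have e : (fun y : R3 => √(‖y‖ ^ 2)) = fun y => ‖y‖ := by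
    funext y; rw [Real.sqrt_sq (norm_nonneg y)]
  rw [e, Real.sqrt_sq hn.le] at h2
  refine h2.congr_fderiv ?_
  rw [← Nat.cast_smul_eq_nsmul ℝ 2, smul_smul]
  congr 1
  push_cast
  field_simp

section radial
variable {ψ : R3 → ℂ}

lemma prof_eq (hr : ∀ x y : R3, ‖x‖ = ‖y‖ → ψ x = ψ y) (x : R3) : ψ x = prof ψ ‖x‖ :=
  hr _ _ (by rw [norm_smul_ev (norm_nonneg x)])

lemma prof_smooth (hs : ContDiff ℝ (⊤ : ℕ∞) ψ) : ContDiff ℝ (⊤ : ℕ∞) (prof ψ) :=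
  hs.comp (contDiff_id.smul contDiff_const)

lemma cd_deriv {w : ℝ → ℂ} (hw : ContDiff ℝ (⊤ : ℕ∞) w) : ContDiff ℝ (⊤ : ℕ∞) (deriv w) :=
  ((contDiff_infty_iff_deriv).1 hw).2

lemma cd_hd {w : ℝ → ℂ} (hw : ContDiff ℝ (⊤ : ℕ∞) w) (r : ℝ) : HasDerivAt w (deriv w r) r :=
  (hw.differentiable (by simp)).differentiableAt.hasDerivAt

lemma rad_hasFDerivAt {w : ℝ → ℂ} (hw : ContDiff ℝ (⊤ : ℕ∞) w) {x : R3} (hx : x ≠ 0) :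
    HasFDerivAt (fun y : R3 => w ‖y‖) ((‖x‖⁻¹ • innerSL ℝ x).smulRight (deriv w ‖x‖)) x := by
  have := (cd_hd hw ‖x‖).hasFDerivAt.comp x (hasFDerivAt_nrm hx)
  exact this

lemma fderiv_rad (hs : ContDiff ℝ (⊤ : ℕ∞) ψ) (hr : ∀ x y : R3, ‖x‖ = ‖y‖ → ψ x = ψ y)
    {x : R3} (hx : x ≠ 0) (z : R3) :
    fderiv ℝ ψ x z = ((‖x‖⁻¹ * inner ℝ x z : ℝ) : ℂ) * deriv (prof ψ) ‖x‖ := by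
  have e : ψ = fun y : R3 => prof ψ ‖y‖ := funext (prof_eq hr)
  have h := rad_hasFDerivAt (prof_smooth hs) hx
  rw [← e] at h
  rw [h.fderiv]
  simp

lemma fderiv_rad_dir (hs : ContDiff ℝ (⊤ : ℕ∞) ψ) (hr : ∀ x y : R3, ‖x‖ = ‖y‖ → ψ x = ψ y)
    {x : R3} (hx : x ≠ 0) :
    fderiv ℝ ψ x (‖x‖⁻¹ • x) = deriv (prof ψ) ‖x‖ := by
  have hn : ‖x‖ ≠ 0 := norm_ne_zero_iff.2 hx
  rw [fderiv_rad hs hr hx, inner_smul_right, real_inner_self_eq_norm_sq]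
  have : ‖x‖⁻¹ * (‖x‖⁻¹ * ‖x‖ ^ 2) = 1 := by field_simp
  rw [this]; simp

lemma prof_deriv_eq (hs : ContDiff ℝ (⊤ : ℕ∞) ψ) (r : ℝ) :
    deriv (prof ψ) r = fderiv ℝ ψ (r • ev) ev := by
  have h := ((hs.differentiable (by simp)) (r • ev)).hasFDerivAt
  have h2 : HasDerivAt (fun s : ℝ => s • ev) ev r := by
    simpa using (hasDerivAt_id r).smul_const ev
  exact (h.comp_hasDerivAt r h2).deriv

lemma prof_deriv_le (hs : ContDiff ℝ (⊤ : ℕ∞) ψ) (hr : ∀ x y : R3, ‖x‖ = ‖y‖ → ψ x = ψ y)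
    (x : R3) : ‖deriv (prof ψ) ‖x‖‖ ≤ ‖fderiv ℝ ψ x‖ := by
  by_cases hx : x = 0
  · subst hx
    rw [norm_zero, prof_deriv_eq hs, zero_smul]
    have := (fderiv ℝ ψ 0).le_opNorm ev
    rwa [norm_ev, mul_one] at this
  · rw [← fderiv_rad_dir hs hr hx]
    have := (fderiv ℝ ψ x).le_opNorm (‖x‖⁻¹ • x)
    have hn : ‖x‖ ≠ 0 := norm_ne_zero_iff.2 hx
    rwa [norm_smul, norm_inv, norm_norm, inv_mul_cancel₀ hn, mul_one] at this

lemma laplacian_rad (hs : ContDiff ℝ (⊤ : ℕ∞) ψ) (hr : ∀ x y : R3, ‖x‖ = ‖y‖ → ψ x = ψ y)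
    {r : ℝ} (h0 : 0 < r) :
    laplacian ψ (r • ev) = deriv (deriv (prof ψ)) r + (2 / r : ℝ) * deriv (prof ψ) r := by
  have hn : ‖r • ev‖ = r := norm_smul_ev h0.le
  have hx : r • ev ≠ 0 := by
    intro h; rw [h, norm_zero] at hn; linarith
  have key : ∀ j : Fin 3, fderiv ℝ (fun y => fderiv ℝ ψ y (EuclideanSpace.single j 1)) (r • ev)
      (EuclideanSpace.single j 1) =
      ((r⁻¹ - (r • ev) j ^ 2 / r ^ 3 : ℝ) : ℂ) * deriv (prof ψ) r +
      (((r • ev) j ^ 2 / r ^ 2 : ℝ) : ℂ) * deriv (deriv (prof ψ)) r := by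
    intro j
    have e : (fun y => fderiv ℝ ψ y (EuclideanSpace.single j 1)) =ᶠ[𝓝 (r • ev)]
        fun y : R3 => (‖y‖⁻¹ * y j) • deriv (prof ψ) ‖y‖ := by
      filter_upwards [isOpen_ne.mem_nhds hx] with y hy
      rw [fderiv_rad hs hr hy, EuclideanSpace.inner_single_right]
      simp
    rw [e.fderiv_eq]
    have d1 := hasFDerivAt_nrm hx
    have d2 : HasFDerivAt (fun y : R3 => y j) (EuclideanSpace.proj j : R3 →L[ℝ] ℝ) (r • ev) :=
      (EuclideanSpace.proj j : R3 →L[ℝ] ℝ).hasFDerivAt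
    have d3 := ((hasDerivAt_inv (norm_ne_zero_iff.2 hx)).comp_hasFDerivAt _ d1).mul d2
    have d4 := d3.smul (rad_hasFDerivAt (cd_deriv (prof_smooth hs)) hx)
    have d5 := d4.fderiv
    simp only [Function.comp_def] at d5
    erw [d5]
    simp [hn, EuclideanSpace.inner_single_right]
    field_simp
    ring
  have h3 : (r : ℂ) ≠ 0 := by exact_mod_cast h0.ne'
  unfold laplacian
  rw [Fin.sum_univ_three, key, key, key]
  simp [ev]
  field_simp
  ring

end radial

/-- Area constant. -/
def c3 : ℝ := 3 * (volume : Measure R3).real (Metric.ball 0 1)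

lemma c3_pos : 0 < c3 := by
  unfold c3
  have : 0 < (volume : Measure R3).real (Metric.ball 0 1) :=
    ENNReal.toReal_pos (Metric.measure_ball_pos _ _ one_pos).ne' measure_ball_lt_top.ne
  positivity

lemma rad_int {E : Type*} [NormedAddCommGroup E] [NormedSpace ℝ E] (h : ℝ → E) :
    ∫ x : R3, h ‖x‖ = c3 • ∫ y in Set.Ioi (0 : ℝ), y ^ 2 • h y := by
  have := integral_fun_norm_addHaar (volume : Measure R3) h
  rw [this]
  simp [c3, mul_smul]
  rw [← Nat.cast_smul_eq_nsmul ℝ 3]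
  norm_num

lemma rad_integrable {E : Type*} [NormedAddCommGroup E] [NormedSpace ℝ E] (h : ℝ → E) :
    Integrable (fun x : R3 => h ‖x‖) ↔ IntegrableOn (fun y => y ^ 2 • h y) (Set.Ioi (0 : ℝ)) := by
  have := integrable_fun_norm_addHaar (volume : Measure R3) (f := h)
  rw [this]
  simp

section sol
variable {N : ℝ → ℝ → ℝ → ℝ} {φ : ℝ → R3 → ℂ}

/-- Reduced radial function. -/
def Uf (φ : ℝ → R3 → ℂ) (p : ℝ × ℝ) : ℂ := (p.2 : ℂ) * φ p.1 (p.2 • ev)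
/-- Real part. -/
def aF (φ : ℝ → R3 → ℂ) (p : ℝ × ℝ) : ℝ := (Uf φ p).re
/-- Imaginary part. -/
def bF (φ : ℝ → R3 → ℂ) (p : ℝ × ℝ) : ℝ := (Uf φ p).im

lemma SolSetting.slice (h : SolSetting N φ) {t : ℝ} (ht : 0 ≤ t) :
    ContDiff ℝ (⊤ : ℕ∞) (φ t) := by
  rw [← contDiffOn_univ]
  exact h.smooth.comp (f := fun x : R3 => (t, x)) (by fun_prop) (fun x _ => ⟨ht, trivial⟩)

lemma SolSetting.smU (h : SolSetting N φ) : ContDiffOn ℝ (⊤ : ℕ∞) (Uf φ) quad := by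
  have h1 : ContDiffOn ℝ (⊤ : ℕ∞) (fun p : ℝ × ℝ => φ p.1 (p.2 • ev)) quad :=
    h.smooth.comp (f := fun p : ℝ × ℝ => (p.1, p.2 • ev)) (by fun_prop)
      (fun p hp => ⟨Set.mem_Ici.2 (le_of_lt (Set.mem_Ioi.1 hp.1)), trivial⟩)
  have h2 : ContDiffOn ℝ (⊤ : ℕ∞) (fun p : ℝ × ℝ => (p.2 : ℂ)) quad :=
    (Complex.ofRealCLM.contDiff.comp contDiff_snd).contDiffOn
  exact h2.mul h1

lemma SolSetting.sa (h : SolSetting N φ) : SmQ (aF φ) :=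
  Complex.reCLM.contDiff.comp_contDiffOn h.smU
lemma SolSetting.sb (h : SolSetting N φ) : SmQ (bF φ) :=
  Complex.imCLM.contDiff.comp_contDiffOn h.smU

lemma hd_re {w : ℝ → ℂ} {c : ℂ} {t : ℝ} (h : HasDerivAt w c t) :
    HasDerivAt (fun s => (w s).re) c.re t :=
  Complex.reCLM.hasFDerivAt.comp_hasDerivAt t h
lemma hd_im {w : ℝ → ℂ} {c : ℂ} {t : ℝ} (h : HasDerivAt w c t) :
    HasDerivAt (fun s => (w s).im) c.im t :=
  Complex.imCLM.hasFDerivAt.comp_hasDerivAt t h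

lemma hd_id (r : ℝ) : HasDerivAt (fun s : ℝ => (s : ℂ)) 1 r := by
  have := Complex.ofRealCLM.hasDerivAt (x := r)
  refine (HasDerivAt.congr_deriv this ?_)
  simp

lemma SolSetting.U_r (h : SolSetting N φ) {t : ℝ} (ht : 0 < t) (r : ℝ) :
    HasDerivAt (fun s => Uf φ (t, s)) (prof (φ t) r + r * deriv (prof (φ t)) r) r := by
  have := (hd_id r).mul (cd_hd (prof_smooth (h.slice ht.le)) r)
  rw [one_mul] at this
  exact this

lemma SolSetting.U_rr (h : SolSetting N φ) {t : ℝ} (ht : 0 < t) (r : ℝ) :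
    HasDerivAt (fun s : ℝ => prof (φ t) s + s * deriv (prof (φ t)) s)
      (2 * deriv (prof (φ t)) r + r * deriv (deriv (prof (φ t))) r) r := by
  have := (cd_hd (prof_smooth (h.slice ht.le)) r).add
    ((hd_id r).mul (cd_hd (cd_deriv (prof_smooth (h.slice ht.le))) r))
  refine this.congr_deriv ?_
  ring

lemma SolSetting.dRa (h : SolSetting N φ) {t r : ℝ} (ht : 0 < t) (hr : 0 < r) :
    dR (aF φ) (t, r) = (prof (φ t) r + r * deriv (prof (φ t)) r).re :=
  h.sa.dR_eq ht hr (hd_re (h.U_r ht r))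
lemma SolSetting.dRb (h : SolSetting N φ) {t r : ℝ} (ht : 0 < t) (hr : 0 < r) :
    dR (bF φ) (t, r) = (prof (φ t) r + r * deriv (prof (φ t)) r).im :=
  h.sb.dR_eq ht hr (hd_im (h.U_r ht r))

lemma SolSetting.dRRa (h : SolSetting N φ) {t r : ℝ} (ht : 0 < t) (hr : 0 < r) :
    dR (dR (aF φ)) (t, r) =
      (2 * deriv (prof (φ t)) r + r * deriv (deriv (prof (φ t))) r).re := by
  refine h.sa.dR.dR_eq ht hr ((hd_re (h.U_rr ht r)).congr_of_eventuallyEq ?_)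
  filter_upwards [lt_mem_nhds hr] with s hs
  exact h.dRa ht hs
lemma SolSetting.dRRb (h : SolSetting N φ) {t r : ℝ} (ht : 0 < t) (hr : 0 < r) :
    dR (dR (bF φ)) (t, r) =
      (2 * deriv (prof (φ t)) r + r * deriv (deriv (prof (φ t))) r).im := by
  refine h.sb.dR.dR_eq ht hr ((hd_im (h.U_rr ht r)).congr_of_eventuallyEq ?_)
  filter_upwards [lt_mem_nhds hr] with s hs
  exact h.dRb ht hs

lemma SolSetting.pde (h : SolSetting N φ) {t r : ℝ} (ht : 0 < t) (hr : 0 < r) :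
    HasDerivAt (fun s => Uf φ (s, r)) (r * deriv (fun s => φ s (r • ev)) t) t ∧
    Complex.I * (r * deriv (fun s => φ s (r • ev)) t) +
      (2 * deriv (prof (φ t)) r + r * deriv (deriv (prof (φ t))) r) =
      (N ‖φ t (r • ev)‖ r t : ℂ) * Uf φ (t, r) := by
  constructor
  · have h1 : ContDiffAt ℝ (⊤ : ℕ∞) (fun p : ℝ × R3 => φ p.1 p.2) (t, r • ev) := by
      refine h.smooth.contDiffAt ?_
      exact prod_mem_nhds (Ici_mem_nhds ht) univ_mem
    have h2 : HasDerivAt (fun s : ℝ => (s, r • ev)) ((1 : ℝ), (0 : R3)) t :=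
      (hasDerivAt_id t).prodMk (hasDerivAt_const t (r • ev))
    have h3 := (h1.differentiableAt (by simp)).hasFDerivAt.comp_hasDerivAt t h2
    exact (h3.differentiableAt.hasDerivAt).const_mul (r : ℂ)
  · have := h.eqn t ht.le (r • ev)
    rw [laplacian_rad (h.slice ht.le) (h.radial t) hr, norm_smul_ev hr.le] at this
    have h3 : (r : ℂ) ≠ 0 := by exact_mod_cast hr.ne'
    have e : Uf φ (t, r) = r * φ t (r • ev) := rfl
    have e2 : (N ‖φ t (r • ev)‖ r t : ℂ) * (r * φ t (r • ev)) =
      r * ((N ‖φ t (r • ev)‖ r t : ℂ) * φ t (r • ev)) := by ring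
    rw [e, e2, ← this]
    push_cast
    field_simp
    ring

lemma SolSetting.pde1 (h : SolSetting N φ) {t r : ℝ} (ht : 0 < t) (hr : 0 < r) :
    dT (aF φ) (t, r) = - dR (dR (bF φ)) (t, r) + N ‖φ t (r • ev)‖ r t * bF φ (t, r) := by
  obtain ⟨h1, h2⟩ := h.pde ht hr
  rw [h.sa.dT_eq ht hr (hd_re h1), h.dRRb ht hr]
  have := congrArg Complex.im h2
  rw [Complex.add_im, Complex.I_mul_im, Complex.im_ofReal_mul] at this
  show _ = _ + _ * (Uf φ (t, r)).im
  linarith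

lemma SolSetting.pde2 (h : SolSetting N φ) {t r : ℝ} (ht : 0 < t) (hr : 0 < r) :
    dT (bF φ) (t, r) = dR (dR (aF φ)) (t, r) - N ‖φ t (r • ev)‖ r t * aF φ (t, r) := by
  obtain ⟨h1, h2⟩ := h.pde ht hr
  rw [h.sb.dT_eq ht hr (hd_im h1), h.dRRa ht hr]
  have := congrArg Complex.re h2
  rw [Complex.add_re, Complex.I_mul_re, Complex.re_ofReal_mul] at this
  show _ = _ - _ * (Uf φ (t, r)).re
  linarith

lemma ab_sq (φ : ℝ → R3 → ℂ) (t r : ℝ) :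
    aF φ (t, r) ^ 2 + bF φ (t, r) ^ 2 = r ^ 2 * ‖prof (φ t) r‖ ^ 2 := by
  have e : Uf φ (t, r) = r * prof (φ t) r := rfl
  have : aF φ (t, r) ^ 2 + bF φ (t, r) ^ 2 = ‖Uf φ (t, r)‖ ^ 2 := by
    rw [← Complex.normSq_eq_norm_sq, Complex.normSq_apply]
    simp only [aF, bF]; ring
  rw [this, e, norm_mul, mul_pow, Complex.norm_real, Real.norm_eq_abs, sq_abs]

lemma SolSetting.P_le (h : SolSetting N φ) {t r : ℝ} (ht : 0 < t) (hr : 2 < r) :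
    dR (aF φ) (t, r) ^ 2 + dR (bF φ) (t, r) ^ 2 ≤
      2 * (r ^ 2 * ‖prof (φ t) r‖ ^ 2) + 2 * (r ^ 2 * ‖deriv (prof (φ t)) r‖ ^ 2) := by
  have r0 : 0 < r := by linarith
  rw [h.dRa ht r0, h.dRb ht r0]
  set X := prof (φ t) r
  set Y := deriv (prof (φ t)) r
  have e : (X + r * Y).re ^ 2 + (X + r * Y).im ^ 2 = ‖X + r * Y‖ ^ 2 := by
    rw [← Complex.normSq_eq_norm_sq, Complex.normSq_apply]; ring
  rw [e]
  have h1 : ‖X + r * Y‖ ≤ ‖X‖ + r * ‖Y‖ := by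
    refine (norm_add_le _ _).trans ?_
    rw [norm_mul, Complex.norm_real, Real.norm_of_nonneg r0.le]
  have h2 : ‖X + r * Y‖ ^ 2 ≤ (‖X‖ + r * ‖Y‖) ^ 2 := by gcongr
  have h3 : 1 * ‖X‖ ^ 2 ≤ r ^ 2 * ‖X‖ ^ 2 := by gcongr; nlinarith
  nlinarith [sq_nonneg (‖X‖ - r * ‖Y‖)]

lemma SolSetting.I1 (h : SolSetting N φ) {t : ℝ} (ht : 0 ≤ t) :
    IntegrableOn (fun r => r ^ 2 * ‖prof (φ t) r‖ ^ 2) (Set.Ioi 0) ∧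
    c3 * ∫ r in Set.Ioi 0, r ^ 2 * ‖prof (φ t) r‖ ^ 2 = ∫ x : R3, ‖φ t x‖ ^ 2 := by
  have e : (fun x : R3 => ‖φ t x‖ ^ 2) = fun x => (fun r => ‖prof (φ t) r‖ ^ 2) ‖x‖ := by
    funext x; rw [prof_eq (h.radial t) x]
  have i := h.l2 t ht
  rw [e] at i
  refine ⟨(rad_integrable _).1 i, ?_⟩
  rw [e]; exact (rad_int _).symm

lemma SolSetting.I3 (h : SolSetting N φ) {t : ℝ} (ht : 0 ≤ t) :
    IntegrableOn (fun r => r ^ 2 * (r * ‖prof (φ t) r‖ ^ 2)) (Set.Ioi 0) ∧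
    c3 * ∫ r in Set.Ioi 0, r ^ 2 * (r * ‖prof (φ t) r‖ ^ 2) = ∫ x : R3, ‖x‖ * ‖φ t x‖ ^ 2 := by
  have e : (fun x : R3 => ‖x‖ * ‖φ t x‖ ^ 2) =
      fun x => (fun r => r * ‖prof (φ t) r‖ ^ 2) ‖x‖ := by
    funext x; rw [prof_eq (h.radial t) x]
  have i : Integrable (fun x : R3 => ‖x‖ * ‖φ t x‖ ^ 2) := by
    refine ((h.wt_l2 t ht).sub (h.l2 t ht)).congr (Eventually.of_forall fun x => ?_)
    simp only [Pi.sub_apply]; ring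
  rw [e] at i
  refine ⟨(rad_integrable _).1 i, ?_⟩
  rw [e]; exact (rad_int _).symm

lemma SolSetting.I2 (h : SolSetting N φ) {t : ℝ} (ht : 0 ≤ t) :
    IntegrableOn (fun r => r ^ 2 * ‖deriv (prof (φ t)) r‖ ^ 2) (Set.Ioi 0) ∧
    c3 * ∫ r in Set.Ioi 0, r ^ 2 * ‖deriv (prof (φ t)) r‖ ^ 2 ≤
      ∫ x : R3, ‖fderiv ℝ (φ t) x‖ ^ 2 := by
  have le : ∀ x : R3, ‖deriv (prof (φ t)) ‖x‖‖ ^ 2 ≤ ‖fderiv ℝ (φ t) x‖ ^ 2 := by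
    intro x
    have := prof_deriv_le (h.slice ht) (h.radial t) x
    gcongr
  have i : Integrable (fun x : R3 => ‖deriv (prof (φ t)) ‖x‖‖ ^ 2) := by
    refine (h.grad_l2 t ht).mono' ?_ (Eventually.of_forall fun x => ?_)
    · have := (cd_deriv (prof_smooth (h.slice ht))).continuous
      exact (by fun_prop : Continuous fun x : R3 => ‖deriv (prof (φ t)) ‖x‖‖ ^ 2).aestronglyMeasurable
    · rw [Real.norm_of_nonneg (by positivity)]; exact le x
  refine ⟨(rad_integrable (fun r => ‖deriv (prof (φ t)) r‖ ^ 2)).1 i, ?_⟩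
  have e := rad_int (fun r => ‖deriv (prof (φ t)) r‖ ^ 2)
  simp only [smul_eq_mul] at e
  rw [← e]
  exact integral_mono i (h.grad_l2 t ht) le

lemma Ioi20 : Set.Ioi (2 : ℝ) ⊆ Set.Ioi 0 := Set.Ioi_subset_Ioi (by norm_num)

lemma SolSetting.iP (h : SolSetting N φ) {t : ℝ} (ht : 0 < t) :
    IntegrableOn (fun r => dR (aF φ) (t, r) ^ 2 + dR (bF φ) (t, r) ^ 2) (Set.Ioi 2) := by
  refine Integrable.mono' (((h.I1 ht.le).1.mono_set Ioi20).const_mul 2 |>.add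
    (((h.I2 ht.le).1.mono_set Ioi20).const_mul 2)) ?_ ?_
  · refine ContinuousOn.aestronglyMeasurable ?_ measurableSet_Ioi
    exact (((h.sa.dR.contOn_slice ht).pow 2).add ((h.sb.dR.contOn_slice ht).pow 2)).mono Ioi20
  · filter_upwards [ae_restrict_mem measurableSet_Ioi] with r hr
    rw [Real.norm_of_nonneg (by positivity)]
    exact h.P_le ht hr

lemma SolSetting.hM (h : SolSetting N φ) : ∃ M, ∀ t : ℝ, 1 ≤ t →
    (∫ r in Set.Ioi 2, (aF φ (t, r) ^ 2 + bF φ (t, r) ^ 2))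
    + (∫ r in Set.Ioi 2, (dR (aF φ) (t, r) ^ 2 + dR (bF φ) (t, r) ^ 2)) ≤ M := by
  obtain ⟨C, hC⟩ := h.H1
  refine ⟨3 * (C / c3), fun t ht => ?_⟩
  have t0 : 0 < t := by linarith
  obtain ⟨i1, e1⟩ := h.I1 t0.le
  obtain ⟨i2, e2⟩ := h.I2 t0.le
  simp only [ab_sq]
  have m1 : ∫ r in Set.Ioi 2, r ^ 2 * ‖prof (φ t) r‖ ^ 2 ≤
      ∫ r in Set.Ioi 0, r ^ 2 * ‖prof (φ t) r‖ ^ 2 :=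
    setIntegral_mono_set i1 (Eventually.of_forall fun r => by positivity) Ioi20.eventuallyLE
  have m2 : ∫ r in Set.Ioi 2, r ^ 2 * ‖deriv (prof (φ t)) r‖ ^ 2 ≤
      ∫ r in Set.Ioi 0, r ^ 2 * ‖deriv (prof (φ t)) r‖ ^ 2 :=
    setIntegral_mono_set i2 (Eventually.of_forall fun r => by positivity) Ioi20.eventuallyLE
  have m3 : (∫ r in Set.Ioi 2, (dR (aF φ) (t, r) ^ 2 + dR (bF φ) (t, r) ^ 2)) ≤
      2 * (∫ r in Set.Ioi 2, r ^ 2 * ‖prof (φ t) r‖ ^ 2) +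
      2 * (∫ r in Set.Ioi 2, r ^ 2 * ‖deriv (prof (φ t)) r‖ ^ 2) := by
    rw [← integral_const_mul, ← integral_const_mul, ← integral_add
      ((i1.mono_set Ioi20).const_mul 2) ((i2.mono_set Ioi20).const_mul 2)]
    exact setIntegral_mono_on (h.iP t0) (((i1.mono_set Ioi20).const_mul 2).add
      ((i2.mono_set Ioi20).const_mul 2)) measurableSet_Ioi (fun r hr => h.P_le t0 hr)
  have hc := c3_pos
  have hh := hC t t0.le
  rw [← e1] at hh
  have p2 : 0 ≤ ∫ r in Set.Ioi 0, r ^ 2 * ‖deriv (prof (φ t)) r‖ ^ 2 :=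
    integral_nonneg fun r => by positivity
  have k : (∫ r in Set.Ioi 0, r ^ 2 * ‖prof (φ t) r‖ ^ 2) +
      ∫ r in Set.Ioi 0, r ^ 2 * ‖deriv (prof (φ t)) r‖ ^ 2 ≤ C / c3 := by
    rw [le_div_iff₀ hc]; nlinarith
  linarith

lemma SolSetting.iR (h : SolSetting N φ) {t : ℝ} (ht : 0 < t) :
    IntegrableOn (fun r => r * (aF φ (t, r) ^ 2 + bF φ (t, r) ^ 2)) (Set.Ioi 2) := by
  refine ((h.I3 ht.le).1.mono_set Ioi20).congr (Eventually.of_forall fun r => ?_)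
  simp only [ab_sq]; ring

lemma SolSetting.sub1 (h : SolSetting N φ)
    (hsub : Tendsto (fun t => (∫ x : R3, ‖x‖ * ‖φ t x‖ ^ 2) / t) atTop (𝓝 0)) :
    Tendsto (fun t => (∫ r in Set.Ioi 2, r * (aF φ (t, r) ^ 2 + bF φ (t, r) ^ 2)) / t)
      atTop (𝓝 0) := by
  have h2 := hsub.const_mul (c3⁻¹)
  rw [mul_zero] at h2
  refine tendsto_of_tendsto_of_tendsto_of_le_of_le' tendsto_const_nhds h2 ?_ ?_
  · filter_upwards [eventually_gt_atTop 0] with t ht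
    refine div_nonneg (setIntegral_nonneg measurableSet_Ioi fun r hr => ?_) ht.le
    have : (0 : ℝ) < r := Ioi20 hr
    positivity
  · filter_upwards [eventually_gt_atTop 0] with t ht
    obtain ⟨i3, e3⟩ := h.I3 ht.le
    rw [← e3, ← mul_div_assoc, inv_mul_cancel_left₀ c3_pos.ne']
    gcongr
    have e : ∫ r in Set.Ioi 2, r * (aF φ (t, r) ^ 2 + bF φ (t, r) ^ 2) =
        ∫ r in Set.Ioi 2, r ^ 2 * (r * ‖prof (φ t) r‖ ^ 2) := by
      congr 1; funext r; rw [ab_sq]; ring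
    rw [e]
    refine setIntegral_mono_set i3 ?_ Ioi20.eventuallyLE
    filter_upwards [ae_restrict_mem measurableSet_Ioi] with r hr
    have : (0 : ℝ) < r := hr
    show 0 ≤ _
    positivity

lemma SolSetting.data {g : R3 → ℝ} {β : ℝ → ℝ} (h : SolSetting N φ) (hg : GoodG g β)
    {F : ℝ → ℝ} (hF : IsSmoothChar F) {α β₀ : ℝ} (hα : α ∈ Set.Ioo (1 / 3 : ℝ) 1)
    (hβ : 1 < β₀) (hH : H2 g N φ α β₀) :
    ∃ M C₀, Data1 (aF φ) (bF φ) (fun t r => N ‖φ t (r • ev)‖ r t) (fun x => F x ^ 2)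
      α β₀ M C₀ := by
  obtain ⟨M, hM⟩ := h.hM
  obtain ⟨C, hC, hCN⟩ := hH F hF
  obtain ⟨D, hD, hb⟩ := char_bounds hF
  have key : ∀ t r : ℝ, 1 ≤ t → 2 ≤ r →
      |N ‖φ t (r • ev)‖ r t * F (r * t ^ (-α))| ≤ C * t ^ (-β₀) := by
    intro t r ht hr
    have := hCN t ht (r • ev)
    rw [hg.g_eq, norm_smul_ev (by linarith), hg.beta_eq_id r hr, div_eq_mul_inv,
      ← rpow_neg (by linarith), mul_comm] at this
    exact this
  refine ⟨M, C * (2 * D), char_sq hF, hα.1, hα.2, hβ, by positivity, h.sa, h.sb,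
    fun t r ht hr => h.pde1 ht hr, fun t r ht hr => h.pde2 ht hr, ?_,
    fun t ht => h.iP (by linarith), fun t ht => h.iR (by linarith), hM, ?_, ?_⟩
  · intro t ht
    simp only [ab_sq]
    exact (h.I1 (by linarith)).1.mono_set Ioi20
  · intro t r ht hr
    have k := key t r ht hr
    have t0 : 0 < t := by linarith
    have f := hF.2.2.2.2 (r * t ^ (-α))
    have p : 0 < t ^ (-β₀) := rpow_pos_of_pos t0 _
    have e : N ‖φ t (r • ev)‖ r t * F (r * t ^ (-α)) ^ 2 =
      N ‖φ t (r • ev)‖ r t * F (r * t ^ (-α)) * F (r * t ^ (-α)) := by ring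
    simp only [e]
    rw [abs_mul, abs_of_nonneg f.1]
    calc _ ≤ C * t ^ (-β₀) * 1 := by
          apply mul_le_mul k f.2 f.1 (by positivity)
      _ ≤ C * t ^ (-β₀) * (2 * D) := by gcongr; linarith
      _ = _ := by ring
  · intro t r ht hr
    have k := key t r ht hr
    have t0 : 0 < t := by linarith
    have p : 0 < t ^ (-β₀) := rpow_pos_of_pos t0 _
    have e0 : deriv (fun x => F x ^ 2) (r * t ^ (-α)) =
        2 * F (r * t ^ (-α)) * deriv F (r * t ^ (-α)) := by
      have := ((hF.1.differentiable (by simp)) (r * t ^ (-α))).hasDerivAt.pow 2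
      refine (HasDerivAt.deriv (f := fun x => F x ^ 2) this).trans ?_
      simp
    have e : N ‖φ t (r • ev)‖ r t * deriv (fun x => F x ^ 2) (r * t ^ (-α)) =
      N ‖φ t (r • ev)‖ r t * F (r * t ^ (-α)) * (2 * deriv F (r * t ^ (-α))) := by
      rw [e0]; ring
    simp only [e]
    rw [abs_mul]
    have b1 := (hb (r * t ^ (-α))).1
    have b2 : |2 * deriv F (r * t ^ (-α))| ≤ 2 * D := by
      rw [abs_mul, abs_two]; gcongr
    calc _ ≤ C * t ^ (-β₀) * (2 * D) := by
          apply mul_le_mul k b2 (abs_nonneg _) (by positivity)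
      _ = _ := by ring

end sol

section fin
variable {N : ℝ → ℝ → ℝ → ℝ} {φ : ℝ → R3 → ℂ} {g : R3 → ℝ} {β : ℝ → ℝ} {F : ℝ → ℝ} {α : ℝ}

lemma grad_g (hg : GoodG g β) {x : R3} (hx : 2 < ‖x‖) : gradient g x = ‖x‖⁻¹ • x := by
  have x0 : x ≠ 0 := by
    rintro rfl; rw [norm_zero] at hx; linarith
  have e : g =ᶠ[𝓝 x] fun y => ‖y‖ := by
    filter_upwards [continuous_norm.continuousAt.eventually (lt_mem_nhds hx)] with y hy
    rw [hg.g_eq, hg.beta_eq_id _ hy.le]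
  have h1 := (hasFDerivAt_nrm x0).congr_of_eventuallyEq e
  have h2 : HasGradientAt g (‖x‖⁻¹ • x) x := by
    rw [hasGradientAt_iff_hasFDerivAt]
    refine h1.congr_fderiv ?_
    ext w
    simp
  exact h2.gradient

/-- The localized function. -/
def psi (g : R3 → ℝ) (φ : ℝ → R3 → ℂ) (F : ℝ → ℝ) (α t : ℝ) (x : R3) : ℂ :=
  (F (g x / t ^ α) : ℂ) * φ t x

lemma psi_smooth (h : SolSetting N φ) (hg : GoodG g β) (hF : IsSmoothChar F) {t : ℝ}
    (ht : 0 ≤ t) : ContDiff ℝ (⊤ : ℕ∞) (psi g φ F α t) := by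
  have h1 : ContDiff ℝ (⊤ : ℕ∞) (fun x : R3 => F (g x / t ^ α)) :=
    hF.1.comp (hg.smooth_g.div_const _)
  exact (Complex.ofRealCLM.contDiff.comp h1).mul (h.slice ht)

lemma psi_radial (h : SolSetting N φ) (hg : GoodG g β) {t : ℝ} (x y : R3) (hxy : ‖x‖ = ‖y‖) :
    psi g φ F α t x = psi g φ F α t y := by
  unfold psi
  rw [hg.g_eq, hg.g_eq, hxy, h.radial t x y hxy]

lemma psi_prof (hg : GoodG g β) {t r : ℝ} (ht : 0 < t) (hr : 2 ≤ r) :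
    prof (psi g φ F α t) r = (F (r * t ^ (-α)) : ℂ) * prof (φ t) r := by
  unfold prof psi
  rw [hg.g_eq, norm_smul_ev (by linarith), hg.beta_eq_id r hr, div_eq_mul_inv,
      ← rpow_neg ht.le]

lemma psi_prof_deriv (h : SolSetting N φ) (hg : GoodG g β) (hF : IsSmoothChar F)
    {t r : ℝ} (ht : 0 < t) (hr : 2 < r) :
    deriv (prof (psi g φ F α t)) r =
      ((deriv F (r * t ^ (-α)) * t ^ (-α) : ℝ) : ℂ) * prof (φ t) r +
      (F (r * t ^ (-α)) : ℂ) * deriv (prof (φ t)) r := by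
  have e : prof (psi g φ F α t) =ᶠ[𝓝 r] fun r => (F (r * t ^ (-α)) : ℂ) * prof (φ t) r := by
    filter_upwards [lt_mem_nhds hr] with s hs
    exact psi_prof hg ht hs.le
  have d0 : HasDerivAt (fun r => r * t ^ (-α)) (t ^ (-α)) r := by
    simpa using (hasDerivAt_id r).mul_const (t ^ (-α))
  have d1 : HasDerivAt (fun r => F (r * t ^ (-α))) (deriv F (r * t ^ (-α)) * t ^ (-α)) r :=
    ((hF.1.differentiable (by simp)) (r * t ^ (-α))).hasDerivAt.comp r d0
  exact e.deriv_eq.trans (d1.ofReal_comp.mul (cd_hd (prof_smooth (h.slice ht.le)) r)).deriv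

lemma GammaF_eq (h : SolSetting N φ) (hg : GoodG g β) (hF : IsSmoothChar F) (hα : 0 < α)
    {t : ℝ} (ht : 1 ≤ t) (ht2 : 2 / t ^ α ≤ 1 / 2) :
    GammaF g φ F α t =
      c3 * ∫ r in Set.Ioi 2, (fun x => F x ^ 2) (r * t ^ (-α)) * dJ (aF φ) (bF φ) t r := by
  have t0 : 0 < t := by linarith
  set ψ := psi g φ F α t with hψ
  have hs : ContDiff ℝ (⊤ : ℕ∞) ψ := psi_smooth h hg hF t0.le
  have hr : ∀ x y : R3, ‖x‖ = ‖y‖ → ψ x = ψ y := fun x y => psi_radial h hg x y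
  set k : ℝ → ℂ := (Set.Ioi (2 : ℝ)).indicator
    (fun r => (starRingEnd ℂ) (prof ψ r) * deriv (prof ψ) r) with hk
  have e1 : (fun x : R3 => (starRingEnd ℂ) (ψ x) * fderiv ℝ ψ x (gradient g x)) =
      fun x => k ‖x‖ := by
    funext x
    by_cases hx : 2 < ‖x‖
    · have x0 : x ≠ 0 := by
        rintro rfl; rw [norm_zero] at hx; linarith
      rw [hk, Set.indicator_of_mem (Set.mem_Ioi.2 hx), grad_g hg hx, fderiv_rad_dir hs hr x0,
        ← prof_eq hr]
    · rw [hk, Set.indicator_of_notMem (by simpa using hx)]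
      have : ψ x = 0 := by
        have b : g x ≤ 2 := by
          rw [hg.g_eq]
          have := hg.mono_beta (Set.mem_Ici.2 (norm_nonneg x)) (Set.mem_Ici.2 (by norm_num : (0:ℝ) ≤ 2))
            (not_lt.1 hx)
          rwa [hg.beta_eq_id 2 le_rfl] at this
        have b2 : g x / t ^ α ≤ 1 / 2 := le_trans (by gcongr) ht2
        simp [hψ, psi, hF.2.2.1 _ b2]
      rw [this]; simp
  have e2 : GammaF g φ F α t = (∫ x : R3, k ‖x‖).im := by
    rw [← e1]; rfl
  have e3 : ∀ y : ℝ, y ^ 2 • k y = (Set.Ioi (2 : ℝ)).indicator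
      (fun r => r ^ 2 • ((starRingEnd ℂ) (prof ψ r) * deriv (prof ψ) r)) y := by
    intro y
    by_cases hy : y ∈ Set.Ioi (2 : ℝ)
    · rw [hk, Set.indicator_of_mem hy, Set.indicator_of_mem hy]
    · rw [hk, Set.indicator_of_notMem hy, Set.indicator_of_notMem hy, smul_zero]
  rw [e2, rad_int]
  simp only [e3]
  rw [setIntegral_indicator measurableSet_Ioi, Set.inter_eq_right.2 Ioi20, Complex.smul_im,
    smul_eq_mul]
  congr 1
  obtain ⟨D, hD, hb⟩ := char_bounds hF
  have tα : 0 < t ^ (-α) := rpow_pos_of_pos t0 _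
  have int : IntegrableOn (fun r => r ^ 2 • ((starRingEnd ℂ) (prof ψ r) * deriv (prof ψ) r))
      (Set.Ioi 2) := by
    refine Integrable.mono' ((((h.I1 t0.le).1.mono_set Ioi20).const_mul (D * t ^ (-α) + 1)).add
      (((h.I2 t0.le).1.mono_set Ioi20).const_mul 1)) ?_ ?_
    · have c1 := (prof_smooth hs).continuous
      have c2 := (cd_deriv (prof_smooth hs)).continuous
      have c3 : Continuous fun r => (starRingEnd ℂ) (prof ψ r) := Complex.continuous_conj.comp c1
      exact ((continuous_pow 2).smul (c3.mul c2)).aestronglyMeasurable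
    · filter_upwards [ae_restrict_mem measurableSet_Ioi] with r hr2
      have hr2' : (2 : ℝ) < r := hr2
      rw [norm_smul, norm_mul, RCLike.norm_conj, psi_prof hg t0 hr2'.le,
        psi_prof_deriv h hg hF t0 hr2', norm_mul, Complex.norm_real,
        Real.norm_of_nonneg (by positivity : 0 ≤ r ^ 2)]
      set X := prof (φ t) r
      set Y := deriv (prof (φ t)) r
      have f := hF.2.2.2.2 (r * t ^ (-α))
      have b := (hb (r * t ^ (-α))).1
      set f0 := F (r * t ^ (-α))
      set f1 := deriv F (r * t ^ (-α))
      have n1 : ‖f0‖ * ‖X‖ ≤ 1 * ‖X‖ := by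
        rw [Real.norm_of_nonneg f.1]; gcongr; exact f.2
      have n2 : ‖((f1 * t ^ (-α) : ℝ) : ℂ) * X + f0 * Y‖ ≤ D * t ^ (-α) * ‖X‖ + 1 * ‖Y‖ := by
        refine (norm_add_le _ _).trans ?_
        rw [norm_mul, norm_mul, Complex.norm_real, Complex.norm_real, norm_mul,
          Real.norm_of_nonneg tα.le, Real.norm_of_nonneg f.1, Real.norm_eq_abs]
        gcongr
        exact f.2
      have n3 := mul_le_mul n1 n2 (norm_nonneg _) (by positivity)
      have n4 : 1 * ‖X‖ * (D * t ^ (-α) * ‖X‖ + 1 * ‖Y‖) ≤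
          (D * t ^ (-α) + 1) * ‖X‖ ^ 2 + 1 * ‖Y‖ ^ 2 := by
        nlinarith [sq_nonneg (‖X‖ - ‖Y‖), sq_nonneg ‖X‖, sq_nonneg ‖Y‖]
      have n5 := mul_le_mul_of_nonneg_left (n3.trans n4) (sq_nonneg r)
      refine n5.trans (le_of_eq ?_)
      simp only [Pi.add_apply]
      ring
  have e4 := integral_im int
  refine (Eq.trans e4.symm ?_)
  refine setIntegral_congr_fun measurableSet_Ioi fun r hr2 => ?_
  have hr2' : (2 : ℝ) < r := hr2
  have r0 : 0 < r := by linarith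
  show (r ^ 2 • ((starRingEnd ℂ) (prof ψ r) * deriv (prof ψ) r)).im = _
  rw [Complex.smul_im, psi_prof hg t0 hr2'.le, psi_prof_deriv h hg hF t0 hr2']
  unfold dJ
  rw [h.dRa t0 r0, h.dRb t0 r0]
  have ea : aF φ (t, r) = r * (prof (φ t) r).re := by
    simp [aF, Uf, prof]
  have eb : bF φ (t, r) = r * (prof (φ t) r).im := by
    simp [bF, Uf, prof]
  rw [ea, eb]
  simp
  ring

end fin
/-- Sublinear spreading implies vanishing γ-limit. -/
theorem sublinear_spreading_gamma_limit_zero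
    (g : R3 → ℝ) (β : ℝ → ℝ) (N : ℝ → ℝ → ℝ → ℝ) (φ : ℝ → R3 → ℂ)
    (hg : GoodG g β) (hφ : SolSetting N φ)
    (hH2 : ∀ α ∈ Set.Ioo (1 / 3 : ℝ) 1, ∃ β₀ > (1 : ℝ), H2 g N φ α β₀)
    (hsub : Tendsto (fun t => (∫ x : R3, ‖x‖ * ‖φ t x‖ ^ 2) / t) atTop (𝓝 0)) :
    ∀ α ∈ Set.Ioo (1 / 3 : ℝ) 1, ∀ F : ℝ → ℝ, IsSmoothChar F →
      Tendsto (fun t => GammaF g φ F α t) atTop (𝓝 0) := by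
  intro α hα F hF
  obtain ⟨β₀, hβ, hH⟩ := hH2 α hα
  obtain ⟨M, C₀, hdat⟩ := hφ.data hg hF hα hβ hH
  have hα0 : 0 < α := lt_trans (by norm_num) hα.1
  have key := (hdat.main (hφ.sub1 hsub)).const_mul c3
  rw [mul_zero] at key
  refine key.congr' ?_
  have h2 : Tendsto (fun t : ℝ => 2 / t ^ α) atTop (𝓝 0) :=
    tendsto_const_nhds.div_atTop (tendsto_rpow_atTop hα0)
  filter_upwards [eventually_ge_atTop 1,
    h2.eventually_le_const (show (0 : ℝ) < 1 / 2 by norm_num)] with t ht ht2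
  exact (GammaF_eq hφ hg hF hα0 ht ht2).symm
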